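/- arXiv:1605.04230 — 6 statements merged into one kernel-verified Lean document; each statement's English description precedes it below -/
import Mathlib

section
/- There is an absolute constant c > 0 such that for every L > 0 and every Lebesgue measurable set J ⊆ ℝ with ∫_J (1+|x|) dx < ∞, |J| = 2L and |J ∩ [0,∞)| = L, one has Φ(χ_J) ≥ Φ(χ_{[−L,L]}) + c·L·∫_{J Δ [−L,L]} ||x|−L| dx, where J Δ [−L,L] is the symmetric difference. -/
open MeasureTheory Filter Topology

theorem map_measureReal_Iic (μ : Measure ℝ) [IsFiniteMeasure μ]
    (hc : Continuous fun x => μ.real (Set.Iic x)) :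
    μ.map (fun x => μ.real (Set.Iic x)) = volume.restrict (Set.Icc 0 (μ.real Set.univ)) := by
  set F : ℝ → ℝ := fun x => μ.real (Set.Iic x) with hF
  set M := μ.real Set.univ with hM
  have hmono : Monotone F := fun x y h => measureReal_mono (Set.Iic_subset_Iic.2 h)
  have h0 : ∀ x, 0 ≤ F x := fun x => measureReal_nonneg
  have h1 : ∀ x, F x ≤ M := fun x => measureReal_mono (Set.subset_univ _)
  have hbot : Tendsto F atBot (𝓝 0) := by
    have hempty : ⋂ x : ℝ, Set.Iic x = ∅ :=
      Set.eq_empty_of_forall_notMem fun y hy =>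
        (sub_one_lt y).not_ge (Set.mem_iInter.1 hy (y - 1))
    have hlim := tendsto_measure_iInter_atBot (μ := μ) (s := fun x : ℝ => Set.Iic x)
      (fun x => measurableSet_Iic.nullMeasurableSet) (fun x y h => Set.Iic_subset_Iic.2 h)
      ⟨0, measure_ne_top _ _⟩
    rw [hempty, measure_empty] at hlim
    exact (ENNReal.tendsto_toReal ENNReal.zero_ne_top).comp hlim
  have htop : Tendsto F atTop (𝓝 M) :=
    (ENNReal.tendsto_toReal (by simp)).comp (tendsto_measure_Iic_atTop μ)
  have hsurj : ∀ s, 0 < s → s < M → ∃ x, F x = s := by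
    intro s hs hs'
    obtain ⟨a, ha⟩ := (hbot.eventually_lt_const hs).exists
    obtain ⟨b, hb⟩ := (htop.eventually_const_lt hs').exists
    exact mem_range_of_exists_le_of_exists_ge hc ⟨a, ha.le⟩ ⟨b, hb.le⟩
  have hlow : ∀ s, 0 < s → s < M → s ≤ μ.real {x | F x ≤ s} := by
    intro s hs hs'
    obtain ⟨x, hx⟩ := hsurj s hs hs'
    calc s = F x := hx.symm
      _ ≤ _ := measureReal_mono fun y hy => (hmono hy).trans hx.le
  have hupp : ∀ s, 0 ≤ s → s < M → μ.real {x | F x ≤ s} ≤ s := by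
    intro s hs hs'
    refine le_of_forall_gt_imp_ge_of_dense fun r hr => ?_
    rcases lt_or_ge r M with h | h
    · obtain ⟨x, hx⟩ := hsurj r (hs.trans_lt hr) h
      calc _ ≤ F x := measureReal_mono fun y hy => by
            by_contra hxy
            have := hmono (not_le.1 hxy).le
            have hy : F y ≤ s := hy
            linarith
        _ = r := hx
    · exact (measureReal_mono (Set.subset_univ _)).trans h
  have : IsFiniteMeasure (μ.map F) := Measure.isFiniteMeasure_map μ F
  refine Measure.ext_of_Iic _ _ fun s => ?_
  rw [Measure.map_apply hc.measurable measurableSet_Iic, Measure.restrict_apply measurableSet_Iic]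
  change μ {x | F x ≤ s} = _
  rw [← ofReal_measureReal]
  rcases lt_or_ge s 0 with hs | hs
  · have e1 : {x | F x ≤ s} = ∅ := by
      ext x; simpa using hs.trans_le (h0 x)
    have e2 : Set.Iic s ∩ Set.Icc 0 M = ∅ := by
      ext x; grind
    simp [e1, e2]
  rcases lt_or_ge s M with hs' | hs'
  · have e2 : Set.Iic s ∩ Set.Icc 0 M = Set.Icc 0 s := by
      ext x; grind
    rw [e2, Real.volume_Icc, sub_zero]
    congr 1
    refine (hupp s hs hs').antisymm ?_
    rcases hs.eq_or_lt with rfl | h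
    · exact measureReal_nonneg
    · exact hlow s h hs'
  · have e1 : {x | F x ≤ s} = Set.univ := by
      ext x; simpa using (h1 x).trans hs'
    have e2 : Set.Iic s ∩ Set.Icc 0 M = Set.Icc 0 M := by
      ext x; grind
    rw [e1, e2, Real.volume_Icc, sub_zero]

theorem setIntegral_sub_setIntegral_eq_symmDiff {α : Type*} [MeasurableSpace α] {μ : Measure α}
    {A B : Set α} (hA : MeasurableSet A) (hB : MeasurableSet B) {f : α → ℝ}
    (hfA : IntegrableOn f A μ) (hfB : IntegrableOn f B μ)
    (hin : ∀ x ∈ B, f x ≤ 0) (hout : ∀ x ∉ B, 0 ≤ f x) :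
    (∫ x in A, f x ∂μ) - ∫ x in B, f x ∂μ = ∫ x in symmDiff A B, |f x| ∂μ := by
  rw [← integral_indicator hA, ← integral_indicator hB, ← integral_indicator (hA.symmDiff hB),
    ← integral_sub ((integrable_indicator_iff hA).2 hfA) ((integrable_indicator_iff hB).2 hfB)]
  congr 1
  ext x
  by_cases h1 : x ∈ A <;> by_cases h2 : x ∈ B <;>
    simp [h1, h2, Set.mem_symmDiff, abs_of_nonneg, abs_of_nonpos, hin, hout]

theorem abs_sub_lower_bound {x y a b s t : ℝ} (hab : |a - b| ≤ |x - y|)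
    (hs : 0 ≤ x ∧ 0 ≤ a ∧ s = 1 ∨ x ≤ 0 ∧ a ≤ 0 ∧ s = -1)
    (ht : 0 ≤ y ∧ 0 ≤ b ∧ t = 1 ∨ y ≤ 0 ∧ b ≤ 0 ∧ t = -1) :
    |a - b| + (1 - s * t) / 2 * ((|x| - |a|) + (|y| - |b|)) ≤ |x - y| := by
  rcases hs with ⟨h1, h2, rfl⟩ | ⟨h1, h2, rfl⟩ <;> rcases ht with ⟨h3, h4, rfl⟩ | ⟨h3, h4, rfl⟩
  · simpa using hab
  · rw [abs_of_nonneg (sub_nonneg.2 (h4.trans h2)), abs_of_nonneg (sub_nonneg.2 (h3.trans h1)),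
      abs_of_nonneg h1, abs_of_nonneg h2, abs_of_nonpos h3, abs_of_nonpos h4]
    linarith
  · rw [abs_of_nonpos (sub_nonpos.2 (h2.trans h4)), abs_of_nonpos (sub_nonpos.2 (h1.trans h3)),
      abs_of_nonpos h1, abs_of_nonpos h2, abs_of_nonneg h3, abs_of_nonneg h4]
    linarith
  · simpa using hab

theorem integrable_abs_sub_prod {μ : Measure ℝ} [IsFiniteMeasure μ] {f : ℝ → ℝ}
    (hf : Integrable f μ) : Integrable (fun p : ℝ × ℝ => |f p.1 - f p.2|) (μ.prod μ) :=
  ((hf.comp_fst μ).sub (hf.comp_snd μ)).abs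

theorem integral_integral_abs_sub_ge {μ : Measure ℝ} [IsFiniteMeasure μ] {T s : ℝ → ℝ}
    (hx : Integrable (fun x => x) μ) (hT : Integrable T μ) (hs : Integrable s μ)
    (hs0 : ∫ x, s x ∂μ = 0) (hlip : ∀ x y, |T x - T y| ≤ |x - y|)
    (hsign : ∀ x, 0 ≤ x ∧ 0 ≤ T x ∧ s x = 1 ∨ x ≤ 0 ∧ T x ≤ 0 ∧ s x = -1) :
    (∫ x, ∫ y, |T x - T y| ∂μ ∂μ) + μ.real Set.univ * ((∫ x, |x| ∂μ) - ∫ x, |T x| ∂μ) ≤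
      ∫ x, ∫ y, |x - y| ∂μ ∂μ := by
  set u : ℝ → ℝ := fun x => |x| - |T x| with hu
  have hui : Integrable u μ := hx.abs.sub hT.abs
  have hsui : Integrable (fun x => s x * u x) μ :=
    hui.bdd_mul (c := 1) hs.aestronglyMeasurable (Eventually.of_forall fun x => by
      rcases hsign x with h | h <;> simp [h.2.2])
  set M := μ.real Set.univ
  set U := ∫ x, u x ∂μ with hU
  set S := ∫ x, s x * u x ∂μ with hS
  have inner : ∀ x, (∫ y, |T x - T y| ∂μ) + (M / 2 * u x + U / 2 - s x * S / 2) ≤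
      ∫ y, |x - y| ∂μ := by
    intro x
    have i1 : Integrable (fun y => |T x - T y|) μ := ((integrable_const _).sub hT).abs
    have i2 : Integrable (fun y => u x / 2 - s x * u x / 2 * s y) μ :=
      (integrable_const _).sub (hs.const_mul _)
    have i3 : Integrable (fun y => u y / 2 - s x / 2 * (s y * u y)) μ :=
      (hui.div_const _).sub (hsui.const_mul _)
    have e2 : ∫ y, (u x / 2 - s x * u x / 2 * s y) ∂μ = M / 2 * u x := by
      rw [integral_sub (integrable_const _) (hs.const_mul _), integral_const_mul, hs0]
      simp only [integral_const, smul_eq_mul, M]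
      ring
    have e3 : ∫ y, (u y / 2 - s x / 2 * (s y * u y)) ∂μ = U / 2 - s x * S / 2 := by
      rw [integral_sub (hui.div_const _) (hsui.const_mul _), integral_const_mul,
        integral_div]
      ring
    have : (∫ y, |T x - T y| ∂μ) + (M / 2 * u x + U / 2 - s x * S / 2) =
        ∫ y, (|T x - T y| + ((u x / 2 - s x * u x / 2 * s y) +
          (u y / 2 - s x / 2 * (s y * u y)))) ∂μ := by
      rw [integral_add i1 (by exact i2.add i3), integral_add i2 i3, e2, e3, add_sub_assoc]
    rw [this]
    refine integral_mono (i1.add (i2.add i3)) ((integrable_const _).sub hx).abs fun y => ?_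
    refine le_of_eq_of_le ?_ (abs_sub_lower_bound (hlip x y) (hsign x) (hsign y))
    simp only [hu]
    ring
  have j1 : Integrable (fun x => ∫ y, |T x - T y| ∂μ) μ :=
    (integrable_abs_sub_prod hT).integral_prod_left
  have j3 : Integrable (fun x => s x * S / 2) μ := (hs.mul_const _).div_const _
  have j2 : Integrable (fun x => M / 2 * u x + U / 2) μ :=
    (hui.const_mul _).add (integrable_const _)
  have e : ∫ x, (M / 2 * u x + U / 2 - s x * S / 2) ∂μ = M * U := by
    rw [integral_sub j2 j3, integral_add (hui.const_mul _) (integrable_const _),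
      integral_const_mul, integral_div, integral_div, integral_mul_const, hs0]
    simp only [integral_const, smul_eq_mul, M, U]
    ring
  have hUe : U = (∫ x, |x| ∂μ) - ∫ x, |T x| ∂μ := integral_sub hx.abs hT.abs
  rw [← hUe, ← e, ← integral_add j1 (by exact j2.sub j3)]
  exact integral_mono (j1.add (j2.sub j3)) (integrable_abs_sub_prod hx).integral_prod_left inner

/-- There is an absolute constant `c > 0` such that for every `L > 0` and every
Lebesgue measurable set `J ⊆ ℝ` with `∫_J (1+|x|) dx < ∞`, `|J| = 2L` and `|J ∩ [0,∞)| = L`,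
one has `Φ(χ_J) ≥ Φ(χ_{[-L,L]}) + c·L·∫_{J Δ [-L,L]} ||x|-L| dx`, where
`Φ(χ_J) = ∫_J ∫_J |x₁ - x₂| dx₁ dx₂`. -/
theorem stmt_0 :
    ∃ c > (0 : ℝ), ∀ L > (0 : ℝ), ∀ J : Set ℝ, MeasurableSet J →
      IntegrableOn (fun x => 1 + |x|) J volume →
      volume J = ENNReal.ofReal (2 * L) →
      volume (J ∩ Set.Ici (0 : ℝ)) = ENNReal.ofReal L →
      (∫ x in J, ∫ y in J, |x - y|) ≥
        (∫ x in Set.Icc (-L) L, ∫ y in Set.Icc (-L) L, |x - y|) +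
          c * L * ∫ x in symmDiff J (Set.Icc (-L) L), |(|x| - L)| := by
  refine ⟨2, two_pos, fun L hL J hJ hint hvol hhalf => ?_⟩
  set μ : Measure ℝ := volume.restrict J with hμ
  have hfin : IsFiniteMeasure μ := ⟨by simp only [hμ, Measure.restrict_apply_univ, hvol, ENNReal.ofReal_lt_top]⟩
  have hM : μ.real Set.univ = 2 * L := by
    simp [hμ, Measure.real, hvol, hL.le]
  have hI : μ.real (Set.Ici 0) = L := by
    simp [hμ, Measure.real, Measure.restrict_apply, Set.inter_comm, hhalf, hL.le]
  have hIio : μ.real (Set.Iio 0) = L := by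
    have := measureReal_compl (μ := μ) (s := Set.Ici (0 : ℝ)) measurableSet_Ici
    rw [Set.compl_Ici] at this
    linarith
  set F : ℝ → ℝ := fun x => μ.real (Set.Iic x) with hF
  have hmono : Monotone F := fun x y h => measureReal_mono (Set.Iic_subset_Iic.2 h)
  have hF0 : F 0 = L := by
    rw [← hIio]
    exact measureReal_congr Iio_ae_eq_Iic.symm
  have hle : ∀ x y, x ≤ y → F y - F x ≤ y - x := by
    intro x y h
    have h1 : F y ≤ F x + μ.real (Set.Ioc x y) := by
      simp only [hF]
      rw [← Set.Iic_union_Ioc_eq_Iic h]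
      exact measureReal_union_le _ _
    have h2 : μ.real (Set.Ioc x y) ≤ y - x := by
      rw [← max_eq_left (sub_nonneg.2 h), ← Real.volume_real_Ioc]
      exact ENNReal.toReal_mono (by simp) (Measure.restrict_apply_le _ _)
    linarith
  have hlip : ∀ x y, |F x - F y| ≤ |x - y| := by
    intro x y
    rcases le_total x y with h | h
    · rw [abs_sub_comm, abs_sub_comm x, abs_of_nonneg (sub_nonneg.2 (hmono h)),
        abs_of_nonneg (sub_nonneg.2 h)]
      exact hle x y h
    · rw [abs_of_nonneg (sub_nonneg.2 (hmono h)), abs_of_nonneg (sub_nonneg.2 h)]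
      exact hle y x h
  have hcont : Continuous F :=
    (LipschitzWith.of_dist_le_mul (K := 1) fun x y => by
      simpa [Real.dist_eq] using hlip x y).continuous
  set T : ℝ → ℝ := fun x => F x - L with hT
  have hTc : Continuous T := hcont.sub continuous_const
  have hmap : μ.map T = volume.restrict (Set.Icc (-L) L) := by
    have h1 : T = (fun x => x - L) ∘ F := rfl
    rw [h1, ← Measure.map_map (by fun_prop) hcont.measurable, map_measureReal_Iic μ hcont, hM]
    have := ((measurePreserving_sub_right (volume : Measure ℝ) L).restrict_preimage
      (measurableSet_Icc (a := -L) (b := L))).map_eq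
    rw [← this]
    congr 2
    rw [Set.preimage_sub_const_Icc, neg_add_cancel, two_mul]
  have hTmap : ∀ f : ℝ → ℝ, Continuous f →
      ∫ x, f (T x) ∂μ = ∫ t in Set.Icc (-L) L, f t := by
    intro f hf
    rw [← hmap, integral_map hTc.aemeasurable hf.aestronglyMeasurable]
  have hxi : Integrable (fun x => x) μ :=
    Integrable.mono' hint continuous_id.aestronglyMeasurable
      (Eventually.of_forall fun x => by simp)
  have hTi : Integrable T μ := by
    have : IntegrableOn (fun x : ℝ => x) (Set.Icc (-L) L) volume :=
      continuous_id.continuousOn.integrableOn_Icc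
    rw [IntegrableOn, ← hmap] at this
    exact this.comp_measurable hTc.measurable
  set s : ℝ → ℝ := fun x => (Set.Ici (0 : ℝ)).indicator 1 x - (Set.Iio (0 : ℝ)).indicator 1 x
    with hs
  have ip : Integrable ((Set.Ici (0 : ℝ)).indicator (1 : ℝ → ℝ)) μ :=
    (integrable_const 1).indicator measurableSet_Ici
  have im : Integrable ((Set.Iio (0 : ℝ)).indicator (1 : ℝ → ℝ)) μ :=
    (integrable_const 1).indicator measurableSet_Iio
  have hs0 : ∫ x, s x ∂μ = 0 := by
    simp only [hs]
    rw [integral_sub ip im, integral_indicator_one measurableSet_Ici,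
      integral_indicator_one measurableSet_Iio, hI, hIio, sub_self]
  have key := integral_integral_abs_sub_ge hxi hTi (ip.sub im) hs0
    (fun x y => by simpa [hT] using hlip x y) (fun x => by
      rcases le_or_gt 0 x with h | h
      · refine Or.inl ⟨h, ?_, ?_⟩
        · simpa [hT, hF0] using hmono h
        · simp [h]
      · refine Or.inr ⟨h.le, ?_, ?_⟩
        · simpa [hT, hF0] using hmono h.le
        · simp [h])
  have hΦ : ∫ x, ∫ y, |T x - T y| ∂μ ∂μ =
      ∫ x in Set.Icc (-L) L, ∫ y in Set.Icc (-L) L, |x - y| := by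
    have h1 : ∀ x, ∫ y, |T x - T y| ∂μ = ∫ y in Set.Icc (-L) L, |T x - y| :=
      fun x => hTmap (fun t => |T x - t|) (by fun_prop)
    simp_rw [h1]
    exact hTmap (fun t => ∫ y in Set.Icc (-L) L, |t - y|)
      (continuous_parametric_integral_of_continuous (by fun_prop) isCompact_Icc)
  have hD : (∫ x, |x| ∂μ) - ∫ x, |T x| ∂μ =
      ∫ x in symmDiff J (Set.Icc (-L) L), |(|x| - L)| := by
    have iI : IntegrableOn (fun x : ℝ => |x|) (Set.Icc (-L) L) volume :=
      continuous_abs.continuousOn.integrableOn_Icc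
    rw [hTmap (fun t => |t|) continuous_abs,
      ← setIntegral_sub_setIntegral_eq_symmDiff (f := fun x => |x| - L) hJ measurableSet_Icc
        (hxi.abs.sub (integrable_const L)) (iI.sub (integrable_const L))
        (fun x hx => sub_nonpos.2 (abs_le.2 hx))
        (fun x hx => sub_nonneg.2 (not_le.1 fun h => hx (abs_le.1 h)).le),
      integral_sub hxi.abs (integrable_const L), integral_sub iI (integrable_const L)]
    have e1 : ∫ _, L ∂μ = 2 * L * L := by simp [hM]
    have e2 : ∫ _ in Set.Icc (-L) L, L = 2 * L * L := by
      rw [setIntegral_const, Real.volume_real_Icc_of_le (by linarith), smul_eq_mul]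
      ring
    rw [e1, e2]
    ring
  rw [hΦ, hD, hM] at key
  exact key
end

section
/- If ρ* ∈ 𝒪 is a minimizer of Φ over 𝒪, i.e. Φ(ρ*) ≤ Φ(ρ) for all ρ ∈ 𝒪, then ρ* is almost everywhere equal to the indicator function of some measurable set A ⊆ ℝ. -/
open MeasureTheory

/-- The interaction density `|x - y| f(x) f(y)` is integrable when `f` has a first moment. -/
lemma integrable_abs_sub_mul {f : ℝ → ℝ} (hf : Measurable f)
    (hi : Integrable fun x => (1 + |x|) * f x) :
    Integrable (fun p : ℝ × ℝ => |p.1 - p.2| * f p.1 * f p.2) (volume.prod volume) := by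
  refine (hi.mul_prod hi).mono ?_ (.of_forall fun p => ?_)
  · exact Measurable.aestronglyMeasurable (by fun_prop)
  · simp only [norm_mul, Real.norm_eq_abs, abs_abs]
    have h1 : |p.1 - p.2| ≤ abs (1 + |p.1|) * abs (1 + |p.2|) := by
      rw [abs_of_nonneg (by positivity : 0 ≤ 1 + |p.1|),
        abs_of_nonneg (by positivity : 0 ≤ 1 + |p.2|)]
      nlinarith [abs_sub p.1 p.2, mul_nonneg (abs_nonneg p.1) (abs_nonneg p.2)]
    calc |p.1 - p.2| * |f p.1| * |f p.2|
        ≤ (abs (1 + |p.1|) * abs (1 + |p.2|)) * |f p.1| * |f p.2| := by gcongr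
      _ = _ := by ring

/-- Functions dominated by a function with a first moment have a first moment. -/
lemma integrable_moment_of_abs_le {f g : ℝ → ℝ} (hf : Measurable f) (C : ℝ)
    (hg : Integrable fun x => (1 + |x|) * g x) (hfg : ∀ x, |f x| ≤ C * g x) :
    Integrable fun x => (1 + |x|) * f x := by
  refine (hg.const_mul C).mono' (Measurable.aestronglyMeasurable (by fun_prop))
    (.of_forall fun x => ?_)
  rw [norm_mul, Real.norm_eq_abs, Real.norm_eq_abs, abs_of_nonneg (by positivity : 0 ≤ 1 + |x|)]
  calc (1 + |x|) * |f x| ≤ (1 + |x|) * (C * g x) := by gcongr; exact hfg x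
    _ = _ := by ring

lemma interaction_defect_nonneg {c x y u v : ℝ} (hu : 0 ≤ (x - c) * u) (hv : 0 ≤ (y - c) * v) :
    0 ≤ (|x - c| + |y - c| - |x - y|) * (u * v) := by
  rcases lt_trichotomy x c with hx | rfl | hx
  · rcases lt_or_ge y c with hy | hy
    · have h1 : u ≤ 0 := by by_contra! h; nlinarith
      have h2 : v ≤ 0 := by by_contra! h; nlinarith
      refine mul_nonneg ?_ (mul_nonneg_of_nonpos_of_nonpos h1 h2)
      rw [abs_of_neg (by linarith), abs_of_neg (by linarith)]
      rcases abs_cases (x - y) with h | h <;> linarith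
    · rw [abs_of_neg (by linarith), abs_of_nonneg (by linarith), abs_of_nonpos (by linarith)]
      apply le_of_eq; ring
  · rw [abs_sub_comm x y]; simp
  · rcases le_or_gt y c with hy | hy
    · rw [abs_of_pos (by linarith), abs_of_nonpos (by linarith), abs_of_nonneg (by linarith)]
      apply le_of_eq; ring
    · have h1 : 0 ≤ u := by by_contra! h; nlinarith
      have h2 : 0 ≤ v := by by_contra! h; nlinarith
      refine mul_nonneg ?_ (mul_nonneg h1 h2)
      rw [abs_of_pos (by linarith), abs_of_pos (by linarith)]
      rcases abs_cases (x - y) with h | h <;> linarith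

/-- Strict conditional negativity of the kernel `|x - y|` on mean-zero functions that change sign
at a single point. -/
lemma ae_eq_zero_of_interaction_nonneg {h : ℝ → ℝ} {c : ℝ} (hm : Measurable h)
    (hi : Integrable fun x => (1 + |x|) * h x) (h0 : ∫ x, h x = 0)
    (hs : ∀ x, 0 ≤ (x - c) * h x)
    (hΦ : 0 ≤ ∫ p : ℝ × ℝ, |p.1 - p.2| * h p.1 * h p.2 ∂(volume.prod volume)) :
    h =ᵐ[volume] 0 := by
  have hint : Integrable h := by
    refine hi.mono hm.aestronglyMeasurable (.of_forall fun x => ?_)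
    rw [norm_mul, Real.norm_eq_abs (1 + |x|), abs_of_nonneg (by positivity : 0 ≤ 1 + |x|)]
    nlinarith [mul_nonneg (abs_nonneg x) (norm_nonneg (h x))]
  have hci : Integrable fun x => |x - c| * h x := by
    refine (hi.const_mul (1 + |c|)).mono (Measurable.aestronglyMeasurable (by fun_prop))
      (.of_forall fun x => ?_)
    simp only [norm_mul, Real.norm_eq_abs, abs_abs]
    rw [abs_of_nonneg (by positivity : 0 ≤ 1 + |x|), abs_of_nonneg (by positivity : 0 ≤ 1 + |c|),
      ← mul_assoc]
    gcongr
    nlinarith [abs_sub x c, mul_nonneg (abs_nonneg x) (abs_nonneg c)]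
  have hK := integrable_abs_sub_mul hm hi
  have hA := hci.mul_prod hint
  have hB := hint.mul_prod hci
  have hD : ∀ p : ℝ × ℝ, (|p.1 - c| + |p.2 - c| - |p.1 - p.2|) * (h p.1 * h p.2) =
      (|p.1 - c| * h p.1) * h p.2 + h p.1 * (|p.2 - c| * h p.2)
        - |p.1 - p.2| * h p.1 * h p.2 := fun p => by ring
  have hDi : Integrable (fun p : ℝ × ℝ =>
      (|p.1 - c| + |p.2 - c| - |p.1 - p.2|) * (h p.1 * h p.2)) (volume.prod volume) := by
    simp_rw [hD]; exact (hA.add hB).sub hK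
  have hDint : ∫ p : ℝ × ℝ, (|p.1 - c| + |p.2 - c| - |p.1 - p.2|) * (h p.1 * h p.2)
      ∂(volume.prod volume) ≤ 0 := by
    simp_rw [hD]
    rw [integral_sub (f := fun p : ℝ × ℝ => (|p.1 - c| * h p.1) * h p.2 +
      h p.1 * (|p.2 - c| * h p.2)) (hA.add hB) hK, integral_add hA hB,
      integral_prod_mul (fun x => |x - c| * h x) h, integral_prod_mul h (fun x => |x - c| * h x),
      h0]
    linarith
  have hDnn : ∀ p : ℝ × ℝ, 0 ≤ (|p.1 - c| + |p.2 - c| - |p.1 - p.2|) * (h p.1 * h p.2) :=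
    fun p => interaction_defect_nonneg (hs p.1) (hs p.2)
  have hD0 := (integral_eq_zero_iff_of_nonneg hDnn hDi).1
    (le_antisymm hDint (integral_nonneg hDnn))
  have hne : ∀ᵐ x : ℝ, x ≠ c := by simp [ae_iff]
  by_contra hcon
  obtain ⟨x, hx, hxc, hxD⟩ :=
    ((Filter.not_eventually.1 hcon).and_eventually (hne.and (Measure.ae_ae_of_ae_prod hD0))).exists
  apply hcon
  simp only [Pi.zero_apply] at hx hxD
  rcases lt_or_gt_of_ne hxc with hlt | hgt
  · refine (integral_eq_zero_iff_of_nonneg_ae ?_ hint).1 h0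
    filter_upwards [hxD, hne] with y hy hyc
    rcases lt_or_gt_of_ne hyc with h1 | h1
    · have h2 : |x - c| + |y - c| - |x - y| ≠ 0 := by
        rw [abs_of_neg (by linarith), abs_of_neg (by linarith)]
        rcases abs_cases (x - y) with h | h <;> intro <;> linarith
      have hy0 : h y = 0 := by simpa [h2, hx] using hy
      exact hy0.ge
    · simp only [Pi.zero_apply]; by_contra! h3; nlinarith [hs y]
  · have hn := (integral_eq_zero_iff_of_nonneg_ae (f := fun y => - h y) ?_ hint.neg).1
      (by rw [integral_neg, h0, neg_zero])
    · filter_upwards [hn] with y hy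
      simpa using hy
    filter_upwards [hxD, hne] with y hy hyc
    rcases lt_or_gt_of_ne hyc with h1 | h1
    · simp only [Pi.zero_apply]; by_contra! h3; nlinarith [hs y]
    · have h2 : |x - c| + |y - c| - |x - y| ≠ 0 := by
        rw [abs_of_pos (by linarith), abs_of_pos (by linarith)]
        rcases abs_cases (x - y) with h | h <;> intro <;> linarith
      have hy0 : h y = 0 := by simpa [h2, hx] using hy
      simp [hy0]

/-- Flipping the sign of a nonnegative function at its median over `(a, b]` gives a function of
mean zero. -/
lemma exists_balanced_sign_change {m : ℝ → ℝ} {a b : ℝ} (hab : a ≤ b) (hm : Measurable m)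
    (hi : Integrable m) (h0 : ∀ x, 0 ≤ m x) :
    ∃ (c : ℝ) (h : ℝ → ℝ), Measurable h ∧ (∀ x, 0 ≤ (x - c) * h x) ∧ (∫ x, h x = 0) ∧
      (∀ x ∈ Set.Ioc a b, |h x| = m x) ∧ ∀ x ∉ Set.Ioc a b, h x = 0 := by
  have hii : ∀ u v, IntervalIntegrable m volume u v := fun u v => hi.intervalIntegrable
  have hmean : (∫ t in a..b, m t) / 2 ∈ Set.Icc (∫ t in a..a, m t) (∫ t in a..b, m t) := by
    have := intervalIntegral.integral_nonneg (μ := volume) hab fun x _ => h0 x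
    rw [intervalIntegral.integral_same]
    constructor <;> linarith
  obtain ⟨c, ⟨hac, hcb⟩, hc⟩ := intermediate_value_Icc hab
    (intervalIntegral.continuous_primitive hii a).continuousOn hmean
  refine ⟨c, fun x => (Set.Ioc c b).indicator m x - (Set.Ioc a c).indicator m x,
    (hm.indicator measurableSet_Ioc).sub (hm.indicator measurableSet_Ioc),
    fun x => ?_, ?_, fun x hx => ?_, fun x hx => ?_⟩
  · beta_reduce
    rcases le_or_gt x c with hxc | hxc
    · rw [Set.indicator_of_notMem (fun h => hxc.not_gt h.1)]
      have := Set.indicator_nonneg (fun x _ => h0 x) x (s := Set.Ioc a c) (f := m)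
      nlinarith
    · rw [Set.indicator_of_notMem (s := Set.Ioc a c) (fun h => hxc.not_ge h.2)]
      have := Set.indicator_nonneg (fun x _ => h0 x) x (s := Set.Ioc c b) (f := m)
      nlinarith
  · rw [integral_sub (hi.indicator measurableSet_Ioc) (hi.indicator measurableSet_Ioc),
      integral_indicator measurableSet_Ioc, integral_indicator measurableSet_Ioc,
      ← intervalIntegral.integral_of_le hac, ← intervalIntegral.integral_of_le hcb]
    have := intervalIntegral.integral_add_adjacent_intervals (hii a c) (hii c b)
    simp only at hc
    linarith
  · beta_reduce
    rcases le_or_gt x c with hxc | hxc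
    · rw [Set.indicator_of_notMem (fun h => hxc.not_gt h.1),
        Set.indicator_of_mem (show x ∈ Set.Ioc a c from ⟨hx.1, hxc⟩)]
      simp [abs_of_nonneg (h0 x)]
    · rw [Set.indicator_of_mem (show x ∈ Set.Ioc c b from ⟨hxc, hx.2⟩),
        Set.indicator_of_notMem (fun h => hxc.not_ge h.2)]
      simp [abs_of_nonneg (h0 x)]
  · beta_reduce
    rw [Set.indicator_of_notMem fun h => hx ⟨hac.trans_lt h.1, h.2⟩,
      Set.indicator_of_notMem fun h => hx ⟨h.1, h.2.trans hcb⟩, sub_zero]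

/-- A bounded density on a half-line, cut into cells with summable first moments, has a first
moment. -/
lemma integrableOn_moment_of_summable {δ : ℝ} {ρ : ℝ → ℝ} (hm : Measurable ρ)
    (h01 : ∀ x, ρ x ∈ Set.Icc (0 : ℝ) 1) {r : ℕ → ℝ} (hr : Summable r)
    (hmom : Summable fun j : ℕ => (j : ℝ) * r j) {a : ℕ → ℝ}
    (ha : ∀ j, ∀ x ∈ Set.Ioc (a j) (a j + δ), |x| ≤ (j + 1) * δ)
    (hint : ∀ j, ∫ x in Set.Ioc (a j) (a j + δ), ρ x = r j) :
    IntegrableOn (fun x => (1 + |x|) * ρ x) (⋃ j, Set.Ioc (a j) (a j + δ)) := by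
  have hρ : ∀ j, IntegrableOn ρ (Set.Ioc (a j) (a j + δ)) := fun j =>
    Integrable.mono' (g := fun _ => (1 : ℝ)) (by simp) hm.aestronglyMeasurable
      (.of_forall fun x => by rw [Real.norm_eq_abs, abs_of_nonneg (h01 x).1]; exact (h01 x).2)
  have hb : ∀ j, ∀ x ∈ Set.Ioc (a j) (a j + δ),
      ‖(1 + |x|) * ρ x‖ ≤ (1 + (j + 1) * δ) * ρ x := fun j x hx => by
    rw [Real.norm_eq_abs, abs_of_nonneg (mul_nonneg (by positivity) (h01 x).1)]
    have := (h01 x).1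
    gcongr
    exact ha j x hx
  have hi : ∀ j, IntegrableOn (fun x => (1 + |x|) * ρ x) (Set.Ioc (a j) (a j + δ)) := fun j =>
    Integrable.mono' ((hρ j).const_mul (1 + (j + 1) * δ))
      (Measurable.aestronglyMeasurable (by fun_prop))
      (ae_restrict_of_forall_mem measurableSet_Ioc (hb j))
  refine integrableOn_iUnion_of_summable_integral_norm hi ?_
  refine Summable.of_nonneg_of_le (fun j => integral_nonneg fun x => norm_nonneg _) (fun j => ?_)
    ((hr.mul_left (1 + δ)).add (hmom.mul_left δ))
  calc ∫ x in Set.Ioc (a j) (a j + δ), ‖(1 + |x|) * ρ x‖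
      ≤ ∫ x in Set.Ioc (a j) (a j + δ), (1 + (j + 1) * δ) * ρ x :=
        setIntegral_mono_on (hi j).norm ((hρ j).const_mul _) measurableSet_Ioc (hb j)
    _ = _ := by rw [integral_const_mul, hint]; ring

/-- A function with values in `[0, 1]` that minimizes the interaction energy among all such
functions with the same mass on each cell `(kδ, (k+1)δ]` only takes the values `0` and `1`. -/
lemma ae_min_eq_zero_of_minimizer {δ : ℝ} (hδ : 0 < δ) {ρ : ℝ → ℝ} (hm : Measurable ρ)
    (h01 : ∀ x, ρ x ∈ Set.Icc (0 : ℝ) 1) (hi : Integrable fun x => (1 + |x|) * ρ x)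
    (hmin : ∀ σ : ℝ → ℝ, Measurable σ → (∀ x, σ x ∈ Set.Icc (0 : ℝ) 1) →
      (∀ k : ℤ, ∫ x in Set.Ioc (k • δ) ((k + 1) • δ), σ x =
        ∫ x in Set.Ioc (k • δ) ((k + 1) • δ), ρ x) →
      (∫ x, ∫ y, |x - y| * ρ x * ρ y) ≤ ∫ x, ∫ y, |x - y| * σ x * σ y) :
    ∀ᵐ x, min (ρ x) (1 - ρ x) = 0 := by
  have hρi : Integrable ρ := by
    refine hi.mono hm.aestronglyMeasurable (.of_forall fun x => ?_)
    rw [norm_mul, Real.norm_eq_abs (1 + |x|), abs_of_nonneg (by positivity : 0 ≤ 1 + |x|)]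
    nlinarith [mul_nonneg (abs_nonneg x) (norm_nonneg (ρ x))]
  have hmm : Measurable fun x => min (ρ x) (1 - ρ x) := by fun_prop
  have hm0 : ∀ x, 0 ≤ min (ρ x) (1 - ρ x) := fun x =>
    le_min (h01 x).1 (by linarith [(h01 x).2])
  have hmi : Integrable fun x => min (ρ x) (1 - ρ x) :=
    hρi.mono' hmm.aestronglyMeasurable (.of_forall fun x => by
      rw [Real.norm_eq_abs, abs_of_nonneg (hm0 x)]; exact min_le_left _ _)
  have hcell : ∀ k : ℤ, ∀ᵐ x, x ∈ Set.Ioc (k • δ) ((k + 1) • δ) →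
      min (ρ x) (1 - ρ x) = 0 := by
    intro k
    obtain ⟨c, h, hhm, hs, h0, habs, hsupp⟩ := exists_balanced_sign_change
      (a := k • δ) (b := (k + 1) • δ) (by rw [add_smul, one_smul]; linarith) hmm hmi hm0
    have hle : ∀ x, |h x| ≤ min (ρ x) (1 - ρ x) := fun x => by
      by_cases hx : x ∈ Set.Ioc (k • δ) ((k + 1) • δ)
      · exact (habs x hx).le
      · rw [hsupp x hx, abs_zero]; exact hm0 x
    have hleρ : ∀ x, |h x| ≤ ρ x := fun x => (hle x).trans (min_le_left _ _)
    have hle1 : ∀ x, |h x| ≤ 1 - ρ x := fun x => (hle x).trans (min_le_right _ _)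
    have hhi : Integrable h := hρi.mono' hhm.aestronglyMeasurable (.of_forall hleρ)
    have hcells : ∀ l : ℤ, ∫ x in Set.Ioc (l • δ) ((l + 1) • δ), h x = 0 := by
      intro l
      by_cases hl : l = k
      · subst hl
        rw [setIntegral_eq_integral_of_forall_compl_eq_zero hsupp, h0]
      · refine setIntegral_eq_zero_of_forall_eq_zero fun x hx => hsupp x ?_
        exact Set.disjoint_left.1 (Set.pairwise_disjoint_Ioc_zsmul δ hl) hx
    have hΦ : ∀ f : ℝ → ℝ, Measurable f → (∀ x, |f x| ≤ 2 * ρ x) →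
        Integrable (fun p : ℝ × ℝ => |p.1 - p.2| * f p.1 * f p.2) (volume.prod volume) :=
      fun f hf hfle => integrable_abs_sub_mul hf (integrable_moment_of_abs_le hf 2 hi hfle)
    have hiter : ∀ f : ℝ → ℝ, Measurable f → (∀ x, |f x| ≤ 2 * ρ x) →
        ∫ x, ∫ y, |x - y| * f x * f y =
          ∫ p : ℝ × ℝ, |p.1 - p.2| * f p.1 * f p.2 ∂(volume.prod volume) :=
      fun f hf hfle => (integral_prod _ (hΦ f hf hfle)).symm
    have hbρ : ∀ x, |ρ x| ≤ 2 * ρ x := fun x => by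
      rw [abs_of_nonneg (h01 x).1]; linarith [(h01 x).1]
    have hbh : ∀ x, |h x| ≤ 2 * ρ x := fun x => by linarith [hleρ x, (h01 x).1]
    have hbp : ∀ x, |ρ x + h x| ≤ 2 * ρ x := fun x => by
      have := abs_le.1 (hleρ x)
      exact abs_le.2 ⟨by linarith [(h01 x).1], by linarith⟩
    have hbm : ∀ x, |ρ x - h x| ≤ 2 * ρ x := fun x => by
      have := abs_le.1 (hleρ x)
      exact abs_le.2 ⟨by linarith [(h01 x).1], by linarith⟩
    have hp := hmin (fun x => ρ x + h x) (hm.add hhm)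
      (fun x => by
        have := abs_le.1 (hleρ x)
        have := abs_le.1 (hle1 x)
        constructor <;> linarith)
      (fun l => by
        rw [integral_add hρi.integrableOn hhi.integrableOn, hcells, add_zero])
    have hq := hmin (fun x => ρ x - h x) (hm.sub hhm)
      (fun x => by
        have := abs_le.1 (hleρ x)
        have := abs_le.1 (hle1 x)
        constructor <;> linarith)
      (fun l => by
        rw [integral_sub hρi.integrableOn hhi.integrableOn, hcells, sub_zero])
    rw [hiter ρ hm hbρ, hiter (fun x => ρ x + h x) (hm.add hhm) hbp] at hp
    rw [hiter ρ hm hbρ, hiter (fun x => ρ x - h x) (hm.sub hhm) hbm] at hq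
    have hpar : (∫ p : ℝ × ℝ, |p.1 - p.2| * (ρ p.1 + h p.1) * (ρ p.2 + h p.2)
          ∂(volume.prod volume)) +
        (∫ p : ℝ × ℝ, |p.1 - p.2| * (ρ p.1 - h p.1) * (ρ p.2 - h p.2) ∂(volume.prod volume)) =
        2 * (∫ p : ℝ × ℝ, |p.1 - p.2| * ρ p.1 * ρ p.2 ∂(volume.prod volume)) +
        2 * (∫ p : ℝ × ℝ, |p.1 - p.2| * h p.1 * h p.2 ∂(volume.prod volume)) := by
      rw [← integral_add (hΦ (fun x => ρ x + h x) (hm.add hhm) hbp)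
          (hΦ (fun x => ρ x - h x) (hm.sub hhm) hbm),
        ← integral_const_mul, ← integral_const_mul,
        ← integral_add ((hΦ _ hm hbρ).const_mul 2) ((hΦ _ hhm hbh).const_mul 2)]
      congr 1
      ext p
      ring
    have hzero := ae_eq_zero_of_interaction_nonneg hhm
      (integrable_moment_of_abs_le hhm 2 hi hbh) h0 hs (by linarith)
    filter_upwards [hzero] with x hx hxk
    rw [← habs x hxk, hx, Pi.zero_apply, abs_zero]
  filter_upwards [ae_all_iff.2 hcell] with x hx
  have hmem : x ∈ ⋃ k : ℤ, Set.Ioc (k • δ) ((k + 1) • δ) := by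
    rw [iUnion_Ioc_zsmul hδ]; trivial
  obtain ⟨k, hk⟩ := Set.mem_iUnion.1 hmem
  exact hx k hk



/-- If `ρ* ∈ 𝒪` is a minimizer of `Φ` over `𝒪`, then `ρ*` is a.e. equal to the
indicator function of some measurable set `A ⊆ ℝ`.  Here
`Φ(ρ) = ∫∫ |x₁-x₂| ρ(x₁) ρ(x₂) dx₁ dx₂`, and `𝒪` is the set of measurable `ρ : ℝ → [0,1]`
with prescribed integrals `ρ_j⁺`, `ρ_j⁻` over the intervals `[jδ,(j+1)δ]` and `[-(j+1)δ,-jδ]`,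
where `Σ ρ_j⁺ = Σ ρ_j⁻ = 1` and `Σ j ρ_j⁺ < ∞`, `Σ j ρ_j⁻ < ∞`. -/
theorem stmt_1 (δ : ℝ) (hδ : 0 < δ) (ρp ρm : ℕ → ℝ)
    (hρp : ∀ j, 0 ≤ ρp j) (hρm : ∀ j, 0 ≤ ρm j)
    (hsump : HasSum ρp 1) (hsumm : HasSum ρm 1)
    (hmomp : Summable fun j : ℕ => (j : ℝ) * ρp j)
    (hmomm : Summable fun j : ℕ => (j : ℝ) * ρm j)
    (O : Set (ℝ → ℝ))
    (hO : O = {ρ | Measurable ρ ∧ (∀ x, ρ x ∈ Set.Icc (0 : ℝ) 1) ∧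
        (∀ j : ℕ, ∫ x in Set.Ioc ((j : ℝ) * δ) (((j : ℝ) + 1) * δ), ρ x = ρp j) ∧
        (∀ j : ℕ, ∫ x in Set.Ioc (-(((j : ℝ) + 1) * δ)) (-((j : ℝ) * δ)), ρ x = ρm j)})
    (ρs : ℝ → ℝ) (hρs : ρs ∈ O)
    (hmin : ∀ ρ ∈ O, (∫ x, ∫ y, |x - y| * ρs x * ρs y) ≤ ∫ x, ∫ y, |x - y| * ρ x * ρ y) :
    ∃ A : Set ℝ, MeasurableSet A ∧ ρs =ᵐ[volume] A.indicator (fun _ => (1 : ℝ)) := by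
  subst hO
  obtain ⟨hm, h01, hp, hn⟩ := hρs
  have hmomi : Integrable fun x => (1 + |x|) * ρs x := by
    have h1 := integrableOn_moment_of_summable hm h01 hsump.summable hmomp
      (a := fun j => j * δ)
      (fun j x hx => by
        have : 0 ≤ (j : ℝ) * δ := by positivity
        exact abs_le.2 ⟨by linarith [hx.1], by linarith [hx.2]⟩)
      (fun j => by rw [← hp j]; congr 3; ring)
    have h2 := integrableOn_moment_of_summable hm h01 hsumm.summable hmomm
      (a := fun j => -((j + 1) * δ))
      (fun j x hx => by
        have : 0 ≤ (j : ℝ) * δ := by positivity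
        exact abs_le.2 ⟨by linarith [hx.1], by linarith [hx.2]⟩)
      (fun j => by rw [← hn j]; congr 3; ring)
    rw [← integrableOn_univ]
    refine (h1.union h2).mono_set fun x _ => ?_
    have hmem : x ∈ ⋃ k : ℤ, Set.Ioc (k • δ) ((k + 1) • δ) := by
      rw [iUnion_Ioc_zsmul hδ]; trivial
    obtain ⟨k, hk⟩ := Set.mem_iUnion.1 hmem
    simp only [zsmul_eq_mul, Int.cast_add, Int.cast_one, Set.mem_Ioc] at hk
    rcases k with j | j
    · refine Or.inl (Set.mem_iUnion.2 ⟨j, ?_⟩)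
      simp only [Int.ofNat_eq_natCast, Int.cast_natCast] at hk
      exact ⟨hk.1, by linarith⟩
    · refine Or.inr (Set.mem_iUnion.2 ⟨j, ?_⟩)
      simp only [Int.cast_negSucc, Nat.cast_add, Nat.cast_one] at hk
      exact ⟨by linarith, by linarith⟩
  have hmin0 := ae_min_eq_zero_of_minimizer hδ hm h01 hmomi fun σ hσ hσ01 hcell => by
    refine hmin σ ⟨hσ, hσ01, fun j => ?_, fun j => ?_⟩
    · rw [← hp j]
      simpa using hcell j
    · rw [← hn j]
      have h1 : (Int.negSucc j) • δ = -(((j : ℝ) + 1) * δ) := by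
        rw [zsmul_eq_mul, Int.cast_negSucc]; push_cast; ring
      have h2 : (Int.negSucc j + 1) • δ = -((j : ℝ) * δ) := by
        rw [add_smul, h1]; simp; ring
      have := hcell (Int.negSucc j)
      rwa [h1, h2] at this
  refine ⟨ρs ⁻¹' {1}, hm (measurableSet_singleton 1), ?_⟩
  filter_upwards [hmin0] with x hx
  by_cases h1 : ρs x = 1
  · rw [Set.indicator_of_mem (show x ∈ ρs ⁻¹' {1} from h1), h1]
  · rw [Set.indicator_of_notMem (show x ∉ ρs ⁻¹' {1} from h1)]
    rcases min_choice (ρs x) (1 - ρs x) with h | h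
    · rw [← h, hx]
    · exact absurd (by linarith) h1
end

section
/- Let δ : ℝ → ℝ be an integrable function with ∫_ℝ δ(x) dx = 0 and ∫_ℝ |x||δ(x)| dx < ∞. Then ∫_ℝ ∫_ℝ |x₁−x₂| δ(x₁) δ(x₂) dx₁ dx₂ ≤ 0, and equality holds if and only if δ = 0 almost everywhere. -/
open MeasureTheory

/-- The difference of two step functions, squared, is the indicator of the interval between
the two jumps. -/
lemma sq_indicator_Iio_sub (x y t : ℝ) :
    ((Set.Iio t).indicator 1 x - (Set.Iio t).indicator 1 y) ^ 2
      = (Set.uIoc x y).indicator (1 : ℝ → ℝ) t := by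
  classical
  simp only [Set.indicator_apply, Set.mem_Iio, Set.mem_uIoc, Pi.one_apply]
  split_ifs <;> grind

lemma integral_indicator_uIoc_one (x y : ℝ) :
    ∫ t, (Set.uIoc x y).indicator (1 : ℝ → ℝ) t = |x - y| := by
  rw [integral_indicator_one measurableSet_uIoc]
  simp [Measure.real, Set.uIoc, max_sub_min_eq_abs, abs_sub_comm x y]

lemma integrable_indicator_uIoc_one (x y : ℝ) :
    Integrable ((Set.uIoc x y).indicator (1 : ℝ → ℝ)) := by
  rw [integrable_indicator_iff measurableSet_uIoc]
  exact integrableOn_const (by simp [Set.uIoc])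

lemma integrable_abs_sub_mul_mul {δ : ℝ → ℝ} (hint : Integrable δ)
    (hmom : Integrable (fun x => |x| * |δ x|)) :
    Integrable (fun p : ℝ × ℝ => |p.1 - p.2| * (δ p.1 * δ p.2)) (volume.prod volume) := by
  have h₁ := hmom.mul_prod hint.abs
  have h₂ := hint.abs.mul_prod hmom
  refine (h₁.add h₂).mono' ?_ (ae_of_all _ fun p => ?_)
  · exact (by fun_prop : Measurable fun p : ℝ × ℝ => |p.1 - p.2|).aestronglyMeasurable.mul
      (hint.mul_prod hint).aestronglyMeasurable
  · simp only [Real.norm_eq_abs, abs_mul, abs_abs, Pi.add_apply]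
    have := mul_le_mul_of_nonneg_right (abs_sub p.1 p.2)
      (mul_nonneg (abs_nonneg (δ p.1)) (abs_nonneg (δ p.2)))
    linarith

lemma measurable_indicator_uIoc_one : Measurable fun q : (ℝ × ℝ) × ℝ =>
    (Set.uIoc q.1.1 q.1.2).indicator (1 : ℝ → ℝ) q.2 := by
  simp_rw [← sq_indicator_Iio_sub]
  have h : Measurable fun p : ℝ × ℝ => (Set.Iio p.2).indicator (1 : ℝ → ℝ) p.1 := by
    have hs : MeasurableSet {p : ℝ × ℝ | p.1 < p.2} :=
      measurableSet_lt measurable_fst measurable_snd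
    exact (measurable_const (a := (1 : ℝ))).indicator hs
  exact ((h.comp (measurable_fst.fst.prodMk measurable_snd)).sub
    (h.comp (measurable_fst.snd.prodMk measurable_snd))).pow_const 2

lemma integrable_indicator_uIoc_mul_mul {δ : ℝ → ℝ} (hint : Integrable δ)
    (hmom : Integrable (fun x => |x| * |δ x|)) :
    Integrable (fun q : (ℝ × ℝ) × ℝ =>
      (Set.uIoc q.1.1 q.1.2).indicator (1 : ℝ → ℝ) q.2 * (δ q.1.1 * δ q.1.2))
      ((volume.prod volume).prod volume) := by
  have hδ : AEStronglyMeasurable (fun q : (ℝ × ℝ) × ℝ => δ q.1.1 * δ q.1.2)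
      ((volume.prod volume).prod volume) :=
    (hint.mul_prod hint).aestronglyMeasurable.comp_fst
  have hasm : AEStronglyMeasurable (fun q : (ℝ × ℝ) × ℝ =>
      (Set.uIoc q.1.1 q.1.2).indicator (1 : ℝ → ℝ) q.2 * (δ q.1.1 * δ q.1.2))
      ((volume.prod volume).prod volume) := measurable_indicator_uIoc_one.aestronglyMeasurable.mul hδ
  rw [integrable_prod_iff hasm]
  have hnorm : ∀ p : ℝ × ℝ,
      ∫ t, ‖(Set.uIoc p.1 p.2).indicator (1 : ℝ → ℝ) t * (δ p.1 * δ p.2)‖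
        = ‖|p.1 - p.2| * (δ p.1 * δ p.2)‖ := fun p => by
    have hnn : ∀ t, 0 ≤ (Set.uIoc p.1 p.2).indicator (1 : ℝ → ℝ) t := fun t =>
      Set.indicator_nonneg (fun _ _ => zero_le_one) t
    simp_rw [norm_mul _ (δ p.1 * δ p.2), Real.norm_of_nonneg (hnn _)]
    rw [integral_mul_const, integral_indicator_uIoc_one, Real.norm_of_nonneg (abs_nonneg _)]
  constructor
  · exact ae_of_all _ fun p => (integrable_indicator_uIoc_one p.1 p.2).mul_const (δ p.1 * δ p.2)
  · simp_rw [hnorm]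
    exact (integrable_abs_sub_mul_mul hint hmom).norm

/-- For fixed `t` and mean-zero `δ`, the integral of the indicator kernel is `-2 G(t)²`, where
`G` is the primitive of `δ`. -/
lemma integral_indicator_uIoc_mul_mul {δ : ℝ → ℝ} (hint : Integrable δ)
    (hzero : ∫ x, δ x = 0) (t : ℝ) :
    ∫ p : ℝ × ℝ, (Set.uIoc p.1 p.2).indicator (1 : ℝ → ℝ) t * (δ p.1 * δ p.2)
      ∂(volume.prod volume) = -2 * (∫ x in Set.Iio t, δ x) ^ 2 := by
  set g := (Set.Iio t).indicator δ with hg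
  have hgi : Integrable g := hint.indicator measurableSet_Iio
  have hG : ∫ x, g x = ∫ x in Set.Iio t, δ x := integral_indicator measurableSet_Iio
  have key : ∀ p : ℝ × ℝ, (Set.uIoc p.1 p.2).indicator (1 : ℝ → ℝ) t * (δ p.1 * δ p.2)
      = (g p.1 * δ p.2 + δ p.1 * g p.2) - 2 * (g p.1 * g p.2) := by
    intro p
    rw [← sq_indicator_Iio_sub]
    simp only [hg, Set.indicator_apply, Pi.one_apply]
    split_ifs <;> ring
  simp_rw [key]
  have hadd : Integrable (fun p : ℝ × ℝ => g p.1 * δ p.2 + δ p.1 * g p.2)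
      (volume.prod volume) := (hgi.mul_prod hint).add (hint.mul_prod hgi)
  rw [integral_sub hadd ((hgi.mul_prod hgi).const_mul 2),
    integral_add (hgi.mul_prod hint) (hint.mul_prod hgi), integral_const_mul,
    integral_prod_mul, integral_prod_mul, integral_prod_mul, hzero, hG]
  ring

lemma integrable_sq_integral_Iio {δ : ℝ → ℝ} (hint : Integrable δ)
    (hzero : ∫ x, δ x = 0) (hmom : Integrable (fun x => |x| * |δ x|)) :
    Integrable (fun t => (∫ x in Set.Iio t, δ x) ^ 2) := by
  have h := (integrable_indicator_uIoc_mul_mul hint hmom).integral_prod_right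
  simp only [integral_indicator_uIoc_mul_mul hint hzero] at h
  simpa using h.const_mul (-2)⁻¹

lemma integral_integral_abs_sub_mul_mul {δ : ℝ → ℝ} (hint : Integrable δ)
    (hzero : ∫ x, δ x = 0) (hmom : Integrable (fun x => |x| * |δ x|)) :
    ∫ x, ∫ y, |x - y| * δ x * δ y = -2 * ∫ t, (∫ x in Set.Iio t, δ x) ^ 2 := by
  have hswap := integral_integral_swap
    (f := fun (p : ℝ × ℝ) (t : ℝ) =>
      (Set.uIoc p.1 p.2).indicator (1 : ℝ → ℝ) t * (δ p.1 * δ p.2))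
    (integrable_indicator_uIoc_mul_mul hint hmom)
  simp only [integral_indicator_uIoc_mul_mul hint hzero, integral_mul_const,
    integral_indicator_uIoc_one, integral_const_mul] at hswap
  rw [← hswap, integral_prod _ (integrable_abs_sub_mul_mul hint hmom)]
  simp only [mul_assoc]

/-- An integrable function whose primitive vanishes almost everywhere vanishes almost
everywhere. -/
lemma ae_eq_zero_of_integral_Iio_ae_eq_zero {δ : ℝ → ℝ} (hint : Integrable δ)
    (h : (fun t => ∫ x in Set.Iio t, δ x) =ᵐ[volume] 0) : δ =ᵐ[volume] 0 := by
  have hprim : ∀ t, ∫ x in (0 : ℝ)..t, δ x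
      = (∫ x in Set.Iio t, δ x) - ∫ x in Set.Iio (0 : ℝ), δ x := fun t => by
    rw [← integral_Iic_eq_integral_Iio, ← integral_Iic_eq_integral_Iio,
      intervalIntegral.integral_Iic_sub_Iic hint.integrableOn hint.integrableOn]
  have hcont : Continuous fun t => ∫ x in Set.Iio t, δ x := by
    have := (intervalIntegral.continuous_primitive
      (fun a b => hint.intervalIntegrable) 0).add
      (continuous_const (y := ∫ x in Set.Iio (0 : ℝ), δ x))
    refine this.congr fun t => ?_
    simp [hprim]
  have hG := (hcont.ae_eq_iff_eq volume continuous_zero).mp h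
  have hF : (fun t => ∫ x in (0 : ℝ)..t, δ x) = fun _ => 0 := by
    ext t
    have h₁ := congrFun hG t
    have h₂ := congrFun hG 0
    simp only [Pi.zero_apply] at h₁ h₂
    rw [hprim, h₁, h₂, sub_zero]
  filter_upwards [LocallyIntegrable.ae_hasDerivAt_integral hint.locallyIntegrable] with x hx
  have := hx 0
  rw [hF] at this
  exact this.unique (hasDerivAt_const x 0)

/-- Let `δ : ℝ → ℝ` be integrable with `∫ δ = 0` and `∫ |x||δ(x)| dx < ∞`.
Then `∫∫ |x₁-x₂| δ(x₁) δ(x₂) dx₁ dx₂ ≤ 0`, with equality iff `δ = 0` a.e. -/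
theorem stmt_2 (δ : ℝ → ℝ) (hint : Integrable δ) (hzero : ∫ x, δ x = 0)
    (hmom : Integrable (fun x => |x| * |δ x|)) :
    (∫ x, ∫ y, |x - y| * δ x * δ y) ≤ 0 ∧
    ((∫ x, ∫ y, |x - y| * δ x * δ y) = 0 ↔ δ =ᵐ[volume] 0) := by
  rw [integral_integral_abs_sub_mul_mul hint hzero hmom]
  have hnn : 0 ≤ fun t => (∫ x in Set.Iio t, δ x) ^ 2 := fun t => sq_nonneg _
  refine ⟨by linarith [integral_nonneg (μ := volume) hnn], fun h => ?_, fun h => ?_⟩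
  · have h₀ : ∫ t, (∫ x in Set.Iio t, δ x) ^ 2 = 0 := by linarith
    rw [integral_eq_zero_iff_of_nonneg hnn (integrable_sq_integral_Iio hint hzero hmom)] at h₀
    refine ae_eq_zero_of_integral_Iio_ae_eq_zero hint ?_
    filter_upwards [h₀] with t ht
    exact pow_eq_zero_iff two_ne_zero |>.mp ht
  · have h₀ : ∀ t, ∫ x in Set.Iio t, δ x = 0 := fun t =>
      integral_eq_zero_of_ae (ae_restrict_of_ae h)
    simp [h₀]
end

section
/- There is an absolute constant c > 0 such that for every L > 0 and every measurable function ρ : ℝ → [0,1] with ∫_ℝ |x| ρ(x) dx < ∞, ∫_0^∞ ρ(x) dx = L and ∫_{−∞}^0 ρ(x) dx = L, one has Φ(ρ) ≥ Φ(χ_{[−L,L]}) + c·L·∫_ℝ ||x|−L| · |ρ(x) − χ_{[−L,L]}(x)| dx. -/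
open MeasureTheory Set Filter Topology

/-- The cost of moving away from the bathtub minimiser `χ_{(0,r]}` of the first moment. -/
lemma setIntegral_abs_sub_mul_abs_sub_indicator {s : Set ℝ} {h : ℝ → ℝ} {r : ℝ} (hr : 0 ≤ r)
    (hsub : Ioc 0 r ⊆ s) (hpos : s ⊆ Ioi 0)
    (h01 : ∀ x, h x ∈ Icc (0 : ℝ) 1) (hi : IntegrableOn h s)
    (hxi : IntegrableOn (fun t => t * h t) s) :
    ∫ t in s, |t - r| * |h t - (Iic r).indicator (fun _ => (1 : ℝ)) t| =
      (∫ t in s, t * h t) - r * (∫ t in s, h t) + r ^ 2 / 2 := by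
  have hinter : s ∩ Iic r = Ioc 0 r := by
    ext t
    constructor
    · rintro ⟨h1, h2⟩
      exact ⟨hpos h1, h2⟩
    · intro ht
      exact ⟨hsub ht, ht.2⟩
  have hpt : ∀ t, |t - r| * |h t - (Iic r).indicator (fun _ => (1 : ℝ)) t| =
      (t * h t - r * h t) - (Iic r).indicator (fun t => t - r) t := by
    intro t
    obtain ⟨h0, h1⟩ := h01 t
    by_cases ht : t ≤ r
    · rw [indicator_of_mem (show t ∈ Iic r from ht), indicator_of_mem (show t ∈ Iic r from ht),
        abs_of_nonpos (by linarith), abs_of_nonpos (by linarith)]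
      ring
    · rw [indicator_of_notMem (show t ∉ Iic r from ht), indicator_of_notMem (show t ∉ Iic r from ht),
        abs_of_nonneg (by linarith), abs_of_nonneg (by linarith)]
      ring
  have hind : IntegrableOn ((Iic r).indicator (fun t => t - r)) s := by
    rw [IntegrableOn, integrable_indicator_iff measurableSet_Iic, IntegrableOn,
      Measure.restrict_restrict measurableSet_Iic, inter_comm, hinter]
    exact (Continuous.integrableOn_Icc (by fun_prop)).mono_set Ioc_subset_Icc_self
  simp_rw [hpt]
  have hdiff : IntegrableOn (fun t => t * h t - r * h t) s := hxi.sub (hi.const_mul r)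
  rw [integral_sub hdiff hind, integral_sub hxi (hi.const_mul r),
    integral_const_mul, setIntegral_indicator measurableSet_Iic, hinter,
    ← intervalIntegral.integral_of_le hr]
  have : ∫ t in (0 : ℝ)..r, (t - r) = -(r ^ 2 / 2) := by
    rw [intervalIntegral.integral_sub (by simp) (by simp)]
    simp
    ring
  rw [this]
  ring

lemma mul_setIntegral_sub_le_setIntegral_mul {s : Set ℝ} {h : ℝ → ℝ} {r : ℝ} (hr : 0 ≤ r)
    (hsub : Ioc 0 r ⊆ s) (hpos : s ⊆ Ioi 0)
    (h01 : ∀ x, h x ∈ Icc (0 : ℝ) 1) (hi : IntegrableOn h s)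
    (hxi : IntegrableOn (fun t => t * h t) s) :
    r * (∫ t in s, h t) - r ^ 2 / 2 ≤ ∫ t in s, t * h t := by
  have h1 := setIntegral_abs_sub_mul_abs_sub_indicator hr hsub hpos h01 hi hxi
  have h2 : 0 ≤ ∫ t in s, |t - r| * |h t - (Iic r).indicator (fun _ => (1 : ℝ)) t| :=
    integral_nonneg fun t => by positivity
  linarith

lemma setIntegral_Ioi_comp_add_right (φ : ℝ → ℝ) (x : ℝ) :
    ∫ t in Ioi 0, φ (t + x) = ∫ y in Ioi x, φ y := by
  have := (measurePreserving_add_right volume x).setIntegral_preimage_emb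
    (measurableEmbedding_addRight x) φ (Ioi x)
  simpa using this

/-- Among densities with prescribed mass on both sides of `x`, the potential at `x` is smallest
when the mass is packed around `x`. -/
lemma le_setIntegral_abs_sub_mul {f : ℝ → ℝ} (h01 : ∀ x, f x ∈ Icc (0 : ℝ) 1)
    (hi : Integrable f) (hxi : Integrable fun t => t * f t) {x : ℝ} (hx : 0 < x) :
    ((∫ t in (0 : ℝ)..x, f t) ^ 2 + (∫ t in Ioi x, f t) ^ 2) / 2 ≤
      ∫ y in Ioi 0, |x - y| * f y := by
  set a := ∫ t in (0 : ℝ)..x, f t with ha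
  set b := ∫ t in Ioi x, f t with hb
  have ha0 : 0 ≤ a := intervalIntegral.integral_nonneg hx.le fun t _ => (h01 t).1
  have hax : a ≤ x := by
    have := intervalIntegral.integral_mono_on (f := f) (g := fun _ => (1 : ℝ)) hx.le
      hi.intervalIntegrable (by simp) fun t _ => (h01 t).2
    simpa using this
  have hb0 : 0 ≤ b := integral_nonneg fun t => (h01 t).1
  have hxf : Integrable fun t => (x - t) * f t := by
    simp_rw [sub_mul]
    exact (hi.const_mul x).sub hxi
  have hxf' : Integrable fun t => (t - x) * f t := by
    simp_rw [sub_mul]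
    exact hxi.sub (hi.const_mul x)
  have hu : Ioi (0 : ℝ) = Ioc 0 x ∪ Ioi x := (Ioc_union_Ioi_eq_Ioi hx.le).symm
  have e1 : EqOn (fun y => |x - y| * f y) (fun y => (x - y) * f y) (Ioc 0 x) := by
    intro y hy
    simp only
    rw [abs_of_nonneg (by linarith [hy.2])]
  have e2 : EqOn (fun y => |x - y| * f y) (fun y => (y - x) * f y) (Ioi x) := by
    intro y hy
    simp only
    rw [abs_of_nonpos (by linarith [show x < y from hy])]
    ring
  rw [hu, setIntegral_union (Ioc_disjoint_Ioi le_rfl) measurableSet_Ioi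
    (hxf.integrableOn.congr_fun e1.symm measurableSet_Ioc)
    (hxf'.integrableOn.congr_fun e2.symm measurableSet_Ioi),
    setIntegral_congr_fun measurableSet_Ioc e1, setIntegral_congr_fun measurableSet_Ioi e2]
  have hleft : a ^ 2 / 2 ≤ ∫ y in Ioc 0 x, (x - y) * f y := by
    have hc : ∫ y in (0 : ℝ)..x, (x - y) * f y = ∫ t in (0 : ℝ)..x, t * f (x - t) := by
      have := intervalIntegral.integral_comp_sub_left (a := 0) (b := x)
        (fun y => (x - y) * f y) x
      simp only [sub_sub_cancel, sub_self, sub_zero] at this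
      exact this.symm
    have hd : ∫ t in (0 : ℝ)..x, f (x - t) = a := by
      rw [intervalIntegral.integral_comp_sub_left (fun y => f y) x]
      simp [ha]
    have hi' : Integrable fun t => f (x - t) := hi.comp_sub_left x
    have hxi' : Integrable fun t => t * f (x - t) := by
      simpa using hxf.comp_sub_left x
    have := mul_setIntegral_sub_le_setIntegral_mul ha0
      (Ioc_subset_Ioc_right hax) (fun t ht => ht.1) (fun t => h01 (x - t))
      hi'.integrableOn hxi'.integrableOn
    rw [← intervalIntegral.integral_of_le hx.le, ← intervalIntegral.integral_of_le hx.le, hd,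
      ← hc] at this
    rw [← intervalIntegral.integral_of_le hx.le]
    linarith
  have hright : b ^ 2 / 2 ≤ ∫ y in Ioi x, (y - x) * f y := by
    have hc : ∫ y in Ioi x, (y - x) * f y = ∫ t in Ioi 0, t * f (t + x) := by
      have := setIntegral_Ioi_comp_add_right (fun y => (y - x) * f y) x
      simpa using this.symm
    have hd : ∫ t in Ioi 0, f (t + x) = b := by
      have := setIntegral_Ioi_comp_add_right f x
      simpa [hb] using this
    have hi' : Integrable fun t => f (t + x) := hi.comp_add_right x
    have hxi' : Integrable fun t => t * f (t + x) := by
      simpa using hxf'.comp_add_right x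
    have := mul_setIntegral_sub_le_setIntegral_mul hb0
      Ioc_subset_Ioi_self subset_rfl (fun t => h01 (t + x))
      hi'.integrableOn hxi'.integrableOn
    rw [hd] at this
    rw [hc]
    linarith
  linarith

lemma setIntegral_Ioi_eq_sub_intervalIntegral {f : ℝ → ℝ} (hi : Integrable f) {x : ℝ} (hx : 0 < x) :
    ∫ t in Ioi x, f t = (∫ t in Ioi 0, f t) - ∫ t in (0 : ℝ)..x, f t := by
  rw [← Ioc_union_Ioi_eq_Ioi hx.le, setIntegral_union (Ioc_disjoint_Ioi le_rfl) measurableSet_Ioi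
    hi.integrableOn hi.integrableOn, intervalIntegral.integral_of_le hx.le]
  ring

lemma integrable_mul_sq_primitive {f : ℝ → ℝ} (hi : Integrable f) (M : ℝ) :
    Integrable fun x => f x * (((∫ t in (0 : ℝ)..x, f t) ^ 2 +
      (M - ∫ t in (0 : ℝ)..x, f t) ^ 2) / 2) := by
  have hcont : Continuous fun x => ∫ t in (0 : ℝ)..x, f t :=
    intervalIntegral.continuous_primitive (fun _ _ => hi.intervalIntegrable) 0
  set K := ∫ t, |f t|
  have hb : ∀ x, |∫ t in (0 : ℝ)..x, f t| ≤ K := fun x =>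
    (intervalIntegral.abs_intervalIntegral_eq (f := f) (a := 0) (b := x) (μ := volume)).le.trans
      ((abs_integral_le_integral_abs).trans
        (setIntegral_le_integral hi.abs (ae_of_all _ fun _ => abs_nonneg _)))
  refine hi.mul_bdd (c := (K ^ 2 + (|M| + K) ^ 2) / 2)
    (by fun_prop) (ae_of_all _ fun x => ?_)
  have h1 := hb x
  rw [Real.norm_eq_abs, abs_of_nonneg (by positivity)]
  have h2 : |M - ∫ t in (0 : ℝ)..x, f t| ≤ |M| + K := (abs_sub _ _).trans (by linarith)
  have h3 := pow_le_pow_left₀ (abs_nonneg _) h1 2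
  have h4 := pow_le_pow_left₀ (abs_nonneg _) h2 2
  rw [sq_abs] at h3 h4
  linarith

lemma setIntegral_mul_sq_primitive {f : ℝ → ℝ} (hi : Integrable f) {M : ℝ}
    (hM : ∫ t in Ioi 0, f t = M) :
    ∫ x in Ioi 0, f x * (((∫ t in (0 : ℝ)..x, f t) ^ 2 +
      (M - ∫ t in (0 : ℝ)..x, f t) ^ 2) / 2) = M ^ 3 / 3 := by
  set F : ℝ → ℝ := fun x => ∫ t in (0 : ℝ)..x, f t with hF
  have hlim : Tendsto F atTop (𝓝 M) := by
    rw [← hM]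
    exact intervalIntegral_tendsto_integral_Ioi 0 hi.integrableOn tendsto_id
  have hint := (integrable_mul_sq_primitive hi M).integrableOn (s := Ioi 0)
  have h1 := intervalIntegral_tendsto_integral_Ioi 0 hint tendsto_id
  let G : ℝ → ℝ := fun x => (1 / 3) * (F x * (F x * F x)) - (M / 2) * (F x * F x)
    + (M ^ 2 / 2) * F x
  have h2 : ∀ n : ℝ, ∫ x in (0 : ℝ)..n, f x * ((F x ^ 2 + (M - F x) ^ 2) / 2) = G n := by
    intro n
    have hac : AbsolutelyContinuousOnInterval F 0 n :=
      hi.intervalIntegrable.absolutelyContinuousOnInterval_intervalIntegral (by simp)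
    have hG : AbsolutelyContinuousOnInterval G 0 n :=
      (((hac.fun_mul (hac.fun_mul hac)).const_mul _).fun_sub ((hac.fun_mul hac).const_mul _)).fun_add
        (hac.const_mul _)
    have hG0 : G 0 = 0 := by simp [G, F]
    have := hG.integral_deriv_eq_sub
    rw [hG0, sub_zero] at this
    rw [← this]
    apply intervalIntegral.integral_congr_ae
    filter_upwards [LocallyIntegrable.ae_hasDerivAt_integral hi.locallyIntegrable] with x hx _
    have hd : HasDerivAt F (f x) x := hx 0
    have := ((((hd.mul (hd.mul hd)).const_mul (1 / 3)).sub ((hd.mul hd).const_mul (M / 2))).add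
      (hd.const_mul (M ^ 2 / 2))).deriv
    refine Eq.trans ?_ this.symm
    simp only [Pi.mul_apply]
    ring
  have h3 : Tendsto G atTop (𝓝 ((1 / 3) * (M * (M * M)) - (M / 2) * (M * M)
    + (M ^ 2 / 2) * M)) :=
    (((hlim.mul (hlim.mul hlim)).const_mul _).sub ((hlim.mul hlim).const_mul _)).add
      (hlim.const_mul _)
  have h4 := tendsto_nhds_unique (h1.congr h2) h3
  rw [h4]
  ring

lemma integral_eq_setIntegral_Ioi_add_neg {φ : ℝ → ℝ} (hφ : Integrable φ) :
    ∫ x, φ x = (∫ x in Ioi 0, φ x) + ∫ x in Ioi 0, φ (-x) := by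
  rw [integral_comp_neg_Ioi, neg_zero, ← integral_add_compl measurableSet_Ioi hφ, compl_Ioi]

lemma integrable_prod_abs_sub_mul_mul {f : ℝ → ℝ} (hm : Measurable f) (hf : ∀ x, 0 ≤ f x)
    (hi : Integrable f) (hxi : Integrable fun t => |t| * f t) :
    Integrable (fun p : ℝ × ℝ => |p.1 - p.2| * f p.1 * f p.2) (volume.prod volume) := by
  refine ((hxi.mul_prod hi).add (hi.mul_prod hxi)).mono' (by fun_prop) (ae_of_all _ fun p => ?_)
  have h1 := hf p.1
  have h2 := hf p.2
  rw [Real.norm_eq_abs, abs_of_nonneg (by positivity)]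
  have := mul_le_mul_of_nonneg_right (abs_sub p.1 p.2) (mul_nonneg h1 h2)
  simp only [Pi.add_apply]
  linarith

lemma setIntegral_Icc_abs_sub {L : ℝ} (hL : 0 < L) :
    ∫ x in Icc (-L) L, ∫ y in Icc (-L) L, |x - y| = 8 * L ^ 3 / 3 := by
  have hin : ∀ x ∈ Icc (-L) L, ∫ y in Icc (-L) L, |x - y| = x ^ 2 + L ^ 2 := by
    intro x hx
    have hc : Continuous fun y => |x - y| := by fun_prop
    rw [integral_Icc_eq_integral_Ioc, ← intervalIntegral.integral_of_le (by linarith),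
      ← intervalIntegral.integral_add_adjacent_intervals (b := x) (hc.intervalIntegrable _ _)
        (hc.intervalIntegrable _ _)]
    have e1 : ∫ y in (-L)..x, |x - y| = ∫ y in (-L)..x, (x - y) := by
      apply intervalIntegral.integral_congr
      intro y hy
      rw [uIcc_of_le hx.1] at hy
      exact abs_of_nonneg (by linarith [hy.2])
    have e2 : ∫ y in x..L, |x - y| = ∫ y in x..L, (y - x) := by
      apply intervalIntegral.integral_congr
      intro y hy
      rw [uIcc_of_le hx.2] at hy
      simp only
      rw [abs_of_nonpos (by linarith [hy.1])]
      ring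
    rw [e1, e2, intervalIntegral.integral_sub (by simp) (by simp),
      intervalIntegral.integral_sub (by simp) (by simp)]
    simp
    ring
  rw [setIntegral_congr_fun measurableSet_Icc hin, integral_Icc_eq_integral_Ioc,
    ← intervalIntegral.integral_of_le (by linarith),
    intervalIntegral.integral_add (Continuous.intervalIntegrable (by fun_prop) _ _) (by simp)]
  simp
  ring

/-- Lower bound for the contribution of one half-line: `g` is the reflected density on the other
half-line. -/
lemma le_setIntegral_potential {f g : ℝ → ℝ} {L : ℝ}
    (hf01 : ∀ x, f x ∈ Icc (0 : ℝ) 1)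
    (hfi : Integrable f) (hgi : Integrable g)
    (hxf : Integrable fun t => t * f t) (hxg : Integrable fun t => t * g t)
    (hfL : ∫ t in Ioi 0, f t = L) (hgL : ∫ t in Ioi 0, g t = L)
    (hint : IntegrableOn (fun x => (∫ y in Ioi 0, |x - y| * f x * f y) +
      ∫ y in Ioi 0, |x + y| * f x * g y) (Ioi 0)) :
    L ^ 3 / 3 + L * (∫ t in Ioi 0, t * f t) + L * (∫ t in Ioi 0, t * g t) ≤
      ∫ x in Ioi 0, ((∫ y in Ioi 0, |x - y| * f x * f y) +
        ∫ y in Ioi 0, |x + y| * f x * g y) := by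
  set B := ∫ t in Ioi 0, t * g t
  have hlow : IntegrableOn (fun x => f x * (((∫ t in (0 : ℝ)..x, f t) ^ 2 +
      (L - ∫ t in (0 : ℝ)..x, f t) ^ 2) / 2)) (Ioi 0) :=
    (integrable_mul_sq_primitive hfi L).integrableOn
  have hxf' : IntegrableOn (fun x => L * (x * f x)) (Ioi 0) := (hxf.const_mul L).integrableOn
  have hf' : IntegrableOn (fun x => B * f x) (Ioi 0) := (hfi.const_mul B).integrableOn
  have hval : ∫ x in Ioi 0, (f x * (((∫ t in (0 : ℝ)..x, f t) ^ 2 +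
      (L - ∫ t in (0 : ℝ)..x, f t) ^ 2) / 2) + L * (x * f x) + B * f x) =
      L ^ 3 / 3 + L * (∫ t in Ioi 0, t * f t) + L * B := by
    have hsum : IntegrableOn (fun x => f x * (((∫ t in (0 : ℝ)..x, f t) ^ 2 +
        (L - ∫ t in (0 : ℝ)..x, f t) ^ 2) / 2) + L * (x * f x)) (Ioi 0) := hlow.add hxf'
    rw [integral_add hsum hf', integral_add hlow hxf', integral_const_mul,
      integral_const_mul, setIntegral_mul_sq_primitive hfi hfL, hfL]
    ring
  rw [← hval]
  refine setIntegral_mono_on ((hlow.add hxf').add hf') hint measurableSet_Ioi fun x hx => ?_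
  have hx0 : 0 < x := hx
  have h1 : ∫ y in Ioi 0, |x - y| * f x * f y = f x * ∫ y in Ioi 0, |x - y| * f y := by
    rw [← integral_const_mul]
    congr 1
    ext y
    ring
  have h2 : ∫ y in Ioi 0, |x + y| * f x * g y = L * (x * f x) + B * f x := by
    have : EqOn (fun y => |x + y| * f x * g y) (fun y => (x * f x) * g y + f x * (y * g y))
        (Ioi 0) := by
      intro y hy
      simp only
      rw [abs_of_pos (add_pos hx0 hy)]
      ring
    rw [setIntegral_congr_fun measurableSet_Ioi this,
      integral_add (hgi.const_mul _).integrableOn (hxg.const_mul _).integrableOn,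
      integral_const_mul, integral_const_mul, hgL]
    ring
  have h3 := le_setIntegral_abs_sub_mul hf01 hfi hxf hx0
  rw [setIntegral_Ioi_eq_sub_intervalIntegral hfi hx0, hfL] at h3
  have h4 := mul_le_mul_of_nonneg_left h3 (hf01 x).1
  rw [h1, h2]
  linarith

/-- There is an absolute constant `c > 0` such that for every `L > 0` and every
measurable `ρ : ℝ → [0,1]` with `∫ |x| ρ(x) dx < ∞`, `∫_0^∞ ρ = L` and `∫_{-∞}^0 ρ = L`,
one has `Φ(ρ) ≥ Φ(χ_{[-L,L]}) + c·L·∫ ||x|-L|·|ρ(x) - χ_{[-L,L]}(x)| dx`. -/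
theorem stmt_3 :
    ∃ c > (0 : ℝ), ∀ L > (0 : ℝ), ∀ ρ : ℝ → ℝ, Measurable ρ →
      (∀ x, ρ x ∈ Set.Icc (0 : ℝ) 1) →
      Integrable (fun x => |x| * ρ x) →
      (∫ x in Set.Ioi (0 : ℝ), ρ x) = L →
      (∫ x in Set.Iio (0 : ℝ), ρ x) = L →
      (∫ x, ∫ y, |x - y| * ρ x * ρ y) ≥
        (∫ x in Set.Icc (-L) L, ∫ y in Set.Icc (-L) L, |x - y|) +
          c * L * ∫ x, |(|x| - L)| * |ρ x - (Set.Icc (-L) L).indicator (fun _ => (1 : ℝ)) x| := by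
  refine ⟨2, by norm_num, fun L hL ρ hm h01 hxρ hR hN => ?_⟩
  have hi : Integrable ρ := by
    have h1 : IntegrableOn ρ (Ioi 0) := by
      by_contra h
      rw [integral_undef h] at hR
      exact hL.ne hR
    have h2 : IntegrableOn ρ (Iio 0) := by
      by_contra h
      rw [integral_undef h] at hN
      exact hL.ne hN
    rw [← integrableOn_univ, ← Iic_union_Ioi (a := (0 : ℝ))]
    exact ((integrableOn_Iic_iff_integrableOn_Iio).2 h2).union h1
  set g : ℝ → ℝ := fun x => ρ (-x) with hg
  have hg01 : ∀ x, g x ∈ Icc (0 : ℝ) 1 := fun x => h01 (-x)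
  have hgi : Integrable g := hi.comp_neg
  have hxf : Integrable fun t => t * ρ t :=
    hxρ.mono (by fun_prop) (ae_of_all _ fun t => by simp)
  have hxg : Integrable fun t => t * g t := by
    simpa [hg] using hxf.comp_neg.neg
  have hgL : ∫ t in Ioi 0, g t = L := by
    rw [hg, integral_comp_neg_Ioi, neg_zero, integral_Iic_eq_integral_Iio, hN]
  have hprod := integrable_prod_abs_sub_mul_mul hm (fun x => (h01 x).1) hi hxρ
  have hV : Integrable fun x => ∫ y, |x - y| * ρ x * ρ y := hprod.integral_prod_left
  have hsec : ∀ x, Integrable fun y => |x - y| * ρ x * ρ y := by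
    intro x
    refine (((hi.const_mul |x|).add hxρ).const_mul (ρ x)).mono' (by fun_prop)
      (ae_of_all _ fun y => ?_)
    have h1 := (h01 x).1
    have h2 := (h01 y).1
    rw [Real.norm_eq_abs, abs_of_nonneg (by positivity)]
    have := mul_le_mul_of_nonneg_right (abs_sub x y) (mul_nonneg h1 h2)
    simp only [Pi.add_apply]
    linarith
  have hVpos : ∀ x, ∫ y, |x - y| * ρ x * ρ y =
      (∫ y in Ioi 0, |x - y| * ρ x * ρ y) + ∫ y in Ioi 0, |x + y| * ρ x * g y := by
    intro x
    rw [integral_eq_setIntegral_Ioi_add_neg (hsec x)]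
    simp [hg]
  have hVneg : ∀ x, ∫ y, |-x - y| * ρ (-x) * ρ y =
      (∫ y in Ioi 0, |x - y| * g x * g y) + ∫ y in Ioi 0, |x + y| * g x * ρ y := by
    intro x
    rw [integral_eq_setIntegral_Ioi_add_neg (hsec (-x)), add_comm]
    congr 2
    · ext y
      rw [hg, ← abs_neg (-x - -y)]
      ring_nf
    · ext y
      rw [hg, ← abs_neg (-x - y)]
      ring_nf
  have hposInt := hV.integrableOn (s := Ioi 0)
  have hnegInt := hV.comp_neg.integrableOn (s := Ioi 0)
  simp_rw [hVpos] at hposInt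
  simp_rw [hVneg] at hnegInt
  have key1 := le_setIntegral_potential h01 hi hgi hxf hxg hR hgL hposInt
  have key2 := le_setIntegral_potential hg01 hgi hi hxg hxf hgL hR hnegInt
  have hD : ∫ x, |(|x| - L)| * |ρ x - (Icc (-L) L).indicator (fun _ => (1 : ℝ)) x| =
      (∫ t in Ioi 0, t * ρ t) + (∫ t in Ioi 0, t * g t) - L ^ 2 := by
    have hDi : Integrable fun x =>
        |(|x| - L)| * |ρ x - (Icc (-L) L).indicator (fun _ => (1 : ℝ)) x| := by
      have hχ : Integrable ((Icc (-L) L).indicator fun _ => (1 : ℝ)) :=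
        (integrable_indicator_iff measurableSet_Icc).2 (by simp [IntegrableOn])
      have hxχ : Integrable ((Icc (-L) L).indicator fun x => |x|) :=
        (integrable_indicator_iff measurableSet_Icc).2
          (Continuous.integrableOn_Icc (by fun_prop))
      have hmχ : Measurable ((Icc (-L) L).indicator fun _ => (1 : ℝ)) :=
        measurable_const.indicator measurableSet_Icc
      refine (((hxρ.add hxχ).add ((hi.add hχ).const_mul L))).mono' (by fun_prop)
        (ae_of_all _ fun x => ?_)
      have h1 := (h01 x).1
      rw [Real.norm_eq_abs, abs_of_nonneg (by positivity)]
      have h2 : |(|x| - L)| ≤ |x| + L := by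
        simpa [abs_of_pos hL] using abs_sub |x| L
      have h0 : 0 ≤ |x| := abs_nonneg x
      simp only [Pi.add_apply]
      by_cases hx : x ∈ Icc (-L) L
      · simp only [indicator_of_mem hx]
        have h3 : |ρ x - 1| ≤ ρ x + 1 := by
          simpa [abs_of_nonneg h1] using abs_sub (ρ x) 1
        have := mul_le_mul h2 h3 (abs_nonneg _) (by positivity)
        linarith
      · simp only [indicator_of_notMem hx, sub_zero, abs_of_nonneg h1]
        have := mul_le_mul_of_nonneg_right h2 h1
        linarith
    rw [integral_eq_setIntegral_Ioi_add_neg hDi]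
    have e1 : EqOn (fun x => |(|x| - L)| * |ρ x - (Icc (-L) L).indicator (fun _ => (1 : ℝ)) x|)
        (fun t => |t - L| * |ρ t - (Iic L).indicator (fun _ => (1 : ℝ)) t|) (Ioi 0) := by
      intro x hx
      have hx0 : 0 < x := hx
      have : x ∈ Icc (-L) L ↔ x ∈ Iic L := ⟨fun h => h.2, fun h => ⟨by linarith, h⟩⟩
      simp only [abs_of_pos hx0, indicator, this]
    have e2 : EqOn
        (fun x => |(|-x| - L)| * |ρ (-x) - (Icc (-L) L).indicator (fun _ => (1 : ℝ)) (-x)|)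
        (fun t => |t - L| * |g t - (Iic L).indicator (fun _ => (1 : ℝ)) t|) (Ioi 0) := by
      intro x hx
      have hx0 : 0 < x := hx
      have : -x ∈ Icc (-L) L ↔ x ∈ Iic L :=
        ⟨fun h => neg_le_neg_iff.1 h.1, fun h => ⟨neg_le_neg h, by linarith⟩⟩
      simp only [abs_neg, abs_of_pos hx0, indicator, this, hg]
    rw [setIntegral_congr_fun measurableSet_Ioi e1, setIntegral_congr_fun measurableSet_Ioi e2,
      setIntegral_abs_sub_mul_abs_sub_indicator hL.le Ioc_subset_Ioi_self
        subset_rfl h01 hi.integrableOn hxf.integrableOn,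
      setIntegral_abs_sub_mul_abs_sub_indicator hL.le Ioc_subset_Ioi_self
        subset_rfl hg01 hgi.integrableOn hxg.integrableOn, hR, hgL]
    ring
  rw [ge_iff_le, hD, setIntegral_Icc_abs_sub hL, integral_eq_setIntegral_Ioi_add_neg hV]
  rw [setIntegral_congr_fun measurableSet_Ioi (fun x _ => hVpos x),
    setIntegral_congr_fun measurableSet_Ioi (fun x _ => hVneg x)]
  linarith
end

section
/- For every real number a, ∫_{−π}^{π} log(cosh(a) − cos(y)) dy = 2π|a| − 2π·log 2. -/
open MeasureTheory Real

lemma sq_norm_circleMap_sub_exp_abs (a y : ℝ) :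
    ‖circleMap 0 1 y - (Real.exp |a| : ℂ)‖ ^ 2 =
      2 * Real.exp |a| * (Real.cosh a - Real.cos y) := by
  rw [← Complex.normSq_eq_norm_sq, ← Real.cosh_abs a, Real.cosh_eq, Real.exp_neg,
    Complex.normSq_apply]
  have h := Real.exp_ne_zero |a|
  simp [circleMap, Complex.exp_ofReal_mul_I_re, Complex.exp_ofReal_mul_I_im,
    -Complex.ofReal_exp]
  field_simp
  linear_combination Real.sin_sq_add_cos_sq y

lemma log_cosh_sub_cos {a y : ℝ} (h : Real.cosh a - Real.cos y ≠ 0) :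
    Real.log (Real.cosh a - Real.cos y) =
      2 * Real.log ‖circleMap 0 1 y - (Real.exp |a| : ℂ)‖ - (|a| + Real.log 2) := by
  have key := congrArg Real.log (sq_norm_circleMap_sub_exp_abs a y)
  rw [Real.log_pow, Real.log_mul (by positivity) h, Real.log_mul two_ne_zero (by positivity),
    Real.log_exp] at key
  rw [Nat.cast_ofNat] at key
  linarith

lemma cosh_sub_cos_ne_zero {a y : ℝ} (hy : y ∈ Set.Ioc (-π) π) (h0 : y ≠ 0) :
    Real.cosh a - Real.cos y ≠ 0 := by
  intro h
  have hc : Real.cos y = 1 :=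
    le_antisymm (Real.cos_le_one y) (by linarith [Real.one_le_cosh a])
  exact h0 ((Real.cos_eq_one_iff_of_lt_of_lt (by linarith [hy.1, Real.pi_pos])
    (by linarith [hy.2, Real.pi_pos])).1 hc)

/-- For every real `a`, `∫_{-π}^{π} log(cosh a - cos y) dy = 2π|a| - 2π log 2`. -/
theorem stmt_4 (a : ℝ) :
    ∫ y in Set.Icc (-π) π, Real.log (Real.cosh a - Real.cos y) =
      2 * π * |a| - 2 * π * Real.log 2 := by
  set f : ℝ → ℝ := fun y ↦ Real.log ‖circleMap 0 1 y - (Real.exp |a| : ℂ)‖ with hf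
  have hper : Function.Periodic f (2 * π) := fun y ↦ by
    simp only [hf, periodic_circleMap (0 : ℂ) 1 y]
  have hπ : -π + 2 * π = π := by ring
  have hint : IntervalIntegrable f volume (-π) π := by
    have h : CircleIntegrable (fun z : ℂ ↦ Real.log ‖z - (Real.exp |a| : ℂ)‖) 0 1 :=
      circleIntegrable_log_norm_sub_const 1
    exact hper.intervalIntegrable₀ (by positivity) h _ _
  have hval : ∫ y in (-π)..π, f y = 2 * π * |a| := by
    have h := circleAverage_log_norm_sub_const_eq_posLog (a := (Real.exp |a| : ℂ))
    have hlog : Real.posLog ‖(Real.exp |a| : ℂ)‖ = |a| := by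
      rw [Complex.norm_real, Real.norm_eq_abs, Real.abs_exp, Real.posLog_eq_log, Real.log_exp]
      rw [Real.abs_exp]
      exact Real.one_le_exp (abs_nonneg a)
    rw [hlog, Real.circleAverage_def, smul_eq_mul,
      inv_mul_eq_iff_eq_mul₀ (by positivity)] at h
    rw [← h]
    have hshift := hper.intervalIntegral_add_eq (-π) 0
    rwa [hπ, zero_add] at hshift
  rw [integral_Icc_eq_integral_Ioc, ← intervalIntegral.integral_of_le (by linarith [Real.pi_pos])]
  calc ∫ y in (-π)..π, Real.log (Real.cosh a - Real.cos y)
      = ∫ y in (-π)..π, (2 * f y - (|a| + Real.log 2)) := by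
        refine intervalIntegral.integral_congr_ae ?_
        filter_upwards [Measure.ae_ne volume (0 : ℝ)] with y h0 hy
        rw [Set.uIoc_of_le (by linarith [Real.pi_pos])] at hy
        exact log_cosh_sub_cos (cosh_sub_cos_ne_zero hy h0)
    _ = 2 * π * |a| - 2 * π * Real.log 2 := by
        rw [intervalIntegral.integral_sub (hint.const_mul 2) (by simp),
          intervalIntegral.integral_const_mul, hval, intervalIntegral.integral_const, smul_eq_mul]
        ring
end

section
/- There exist constants c > 0 and L₀ > 2 such that for every L > L₀ and every measurable set E ⊆ S with |E| = 4πL, centered around the origin and satisfying ∫_E |x| dz < ∞, one has F(χ_E) ≥ F(χ_{E₀}) + c·L·∫_{E Δ E₀} ||x|−L| dz, where E₀ = [−L,L] × 𝕋. In particular, E₀ minimizes the regularized energy F among all such sets E. -/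
open MeasureTheory Real

noncomputable section

instance : Fact (0 < 2 * π) := ⟨by positivity⟩

/-- The circle `𝕋 = ℝ/(2πℤ)` of circumference `2π`, carrying its Haar measure of mass `2π`. -/
abbrev Torus : Type := AddCircle (2 * π)

/-- The infinite strip `S = ℝ × 𝕋` with the product of Lebesgue and Haar measure. -/
abbrev Strip : Type := ℝ × Torus

/-- `cos`, well-defined on `𝕋 = ℝ/(2πℤ)`. -/
def cosT : Torus → ℝ := Real.cos_periodic.lift

/-- `sin`, well-defined on `𝕋 = ℝ/(2πℤ)`. -/
def sinT : Torus → ℝ := Real.sin_periodic.lift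

/-- The regularized energy `F(χ_E) = ∫_E ∫_E log(cosh(x₁-x₂) - cos(y₁-y₂)) dz dξ`. -/
def Freg (E : Set Strip) : ℝ :=
  ∫ z in E, ∫ ξ in E, Real.log (Real.cosh (z.1 - ξ.1) - cosT (z.2 - ξ.2))

open scoped ENNReal

lemma cosT_coe (θ : ℝ) : cosT (θ : Torus) = Real.cos θ :=
  Real.cos_periodic.lift_coe θ

lemma continuous_cosT : Continuous cosT :=
  continuous_coinduced_dom.mpr Real.continuous_cos

lemma cosT_neg (y : Torus) : cosT (-y) = cosT y := by
  induction y using QuotientAddGroup.induction_on with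
  | H θ => exact (cosT_coe (-θ)).trans ((Real.cos_neg θ).trans (cosT_coe θ).symm)

lemma neg_one_le_cosT (y : Torus) : -1 ≤ cosT y := by
  induction y using QuotientAddGroup.induction_on with
  | H θ => exact (Real.neg_one_le_cos θ).trans_eq (cosT_coe θ).symm

lemma cosT_le_one (y : Torus) : cosT y ≤ 1 := by
  induction y using QuotientAddGroup.induction_on with
  | H θ => exact (cosT_coe θ).trans_le (Real.cos_le_one θ)

/-- The part of the kernel `log (cosh a - cos y)` which remains after removing its vertical
average `|a| - log 2`. -/
def oscKernel (a : ℝ) (y : Torus) : ℝ :=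
  Real.log (Real.cosh a - cosT y) - |a| + Real.log 2

lemma log_cosh_sub_cosT (a : ℝ) (y : Torus) :
    Real.log (Real.cosh a - cosT y) = |a| - Real.log 2 + oscKernel a y := by
  rw [oscKernel]; ring

lemma oscKernel_neg (a : ℝ) (y : Torus) : oscKernel (-a) (-y) = oscKernel a y := by
  simp [oscKernel, cosT_neg]

lemma measurable_oscKernel : Measurable (Function.uncurry oscKernel) := by
  have := continuous_cosT.measurable
  have := Real.continuous_cosh.measurable
  unfold oscKernel Function.uncurry
  fun_prop

lemma oscKernel_le (a : ℝ) (y : Torus) : oscKernel a y ≤ 2 * Real.log 2 := by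
  have h1 := neg_one_le_cosT y
  have h2 := cosT_le_one y
  have h3 := Real.one_le_cosh a
  have h4 : Real.cosh a ≤ Real.exp |a| := by
    rw [← Real.cosh_abs, Real.cosh_eq]
    have : Real.exp (-|a|) ≤ Real.exp |a| := Real.exp_le_exp.mpr (by linarith [abs_nonneg a])
    linarith
  have h5 : (1 : ℝ) ≤ Real.exp |a| := Real.one_le_exp (abs_nonneg a)
  have hlog : 0 < Real.log 2 := Real.log_pos one_lt_two
  unfold oscKernel
  rcases (sub_nonneg.mpr (h2.trans h3)).eq_or_lt with h | h
  · rw [← h, Real.log_zero]; linarith [abs_nonneg a]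
  · have : Real.log (Real.cosh a - cosT y) ≤ Real.log (2 * Real.exp |a|) :=
      Real.log_le_log h (by linarith)
    rw [Real.log_mul two_ne_zero (Real.exp_pos _).ne', Real.log_exp] at this
    linarith

lemma oscKernel_coe_eq (a : ℝ) {θ : ℝ} (h : Real.cos θ < 1) :
    oscKernel a (θ : Torus) = 2 * Real.log ‖circleMap 0 (Real.exp (-|a|)) θ - 1‖ := by
  have hc := Real.one_le_cosh a
  set r := Real.exp (-|a|) with hr
  have hr0 : 0 < r := Real.exp_pos _
  have hcosh : 2 * r * Real.cosh a = r ^ 2 + 1 := by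
    have : r * Real.exp |a| = 1 := by rw [hr, ← Real.exp_add]; simp
    rw [← Real.cosh_abs, Real.cosh_eq, ← hr]
    linear_combination this
  have hnorm : ‖circleMap 0 r θ - 1‖ ^ 2 = 2 * r * (Real.cosh a - Real.cos θ) := by
    rw [← Complex.normSq_eq_norm_sq, Complex.normSq_apply]
    have h1 : (circleMap 0 r θ - 1).re = r * Real.cos θ - 1 := by
      simp [circleMap, Complex.exp_ofReal_mul_I_re]
    have h2 : (circleMap 0 r θ - 1).im = r * Real.sin θ := by
      simp [circleMap, Complex.exp_ofReal_mul_I_im]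
    rw [h1, h2]
    linear_combination r ^ 2 * Real.sin_sq_add_cos_sq θ - hcosh
  have h3 : 2 * Real.log ‖circleMap 0 r θ - 1‖ = Real.log (‖circleMap 0 r θ - 1‖ ^ 2) := by
    rw [Real.log_pow]; norm_num
  have h4 : 0 < Real.cosh a - Real.cos θ := by linarith
  rw [h3, hnorm, Real.log_mul (by positivity) h4.ne', Real.log_mul two_ne_zero hr0.ne', hr,
    Real.log_exp, oscKernel, cosT_coe]
  ring

lemma oscKernel_coe_ae (a : ℝ) :
    (fun θ : ℝ => oscKernel a (θ : Torus)) =ᵐ[volume.restrict (Set.Ioc 0 (0 + 2 * π))]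
      fun θ => 2 * Real.log ‖circleMap 0 (Real.exp (-|a|)) θ - 1‖ := by
  rw [Filter.EventuallyEq, ae_restrict_iff' measurableSet_Ioc]
  filter_upwards [compl_mem_ae_iff.mpr (measure_singleton (2 * π))] with θ hθ hθ'
  refine oscKernel_coe_eq a (lt_of_le_of_ne (Real.cos_le_one θ) fun h => ?_)
  rw [zero_add] at hθ'
  have := (Real.cos_eq_one_iff_of_lt_of_lt (by linarith [hθ'.1, Real.pi_pos])
    (lt_of_le_of_ne hθ'.2 hθ)).mp h
  linarith [hθ'.1]

lemma integrable_oscKernel (a : ℝ) : Integrable (oscKernel a) := by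
  have h := circleIntegrable_log_norm_sub_const (a := (1 : ℂ)) (c := 0) (Real.exp (-|a|))
  rw [CircleIntegrable, intervalIntegrable_iff_integrableOn_Ioc_of_le (by positivity)] at h
  rw [← (AddCircle.measurePreserving_mk (2 * π) 0).integrable_comp
    (measurable_oscKernel.of_uncurry_left).aestronglyMeasurable]
  refine (Integrable.congr ?_ (oscKernel_coe_ae a).symm)
  rw [zero_add]
  exact h.const_mul 2

lemma integral_oscKernel (a : ℝ) : ∫ y, oscKernel a y = 0 := by
  rw [← AddCircle.integral_preimage (2 * π) 0, integral_congr_ae (oscKernel_coe_ae a),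
    integral_const_mul, zero_add, ← intervalIntegral.integral_of_le (by positivity)]
  have h := circleAverage_log_norm_sub_const_eq_log_radius_add_posLog (a := (1 : ℂ)) (c := 0)
    (Real.exp_pos (-|a|)).ne'
  rw [Real.circleAverage_def] at h
  have h2 : Real.posLog ((Real.exp (-|a|))⁻¹ * ‖(0 : ℂ) - 1‖) = |a| := by
    rw [← Real.exp_neg]
    simp only [neg_neg, zero_sub, norm_neg, norm_one, mul_one]
    rw [Real.posLog_eq_log, Real.log_exp]
    rw [abs_of_pos (Real.exp_pos _)]
    exact Real.one_le_exp (abs_nonneg a)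
  rw [h2, Real.log_exp, neg_add_cancel, smul_eq_mul, mul_eq_zero] at h
  rcases h with h | h
  · exact absurd h (by positivity)
  · rw [h, mul_zero]

lemma volume_real_torus : volume.real (Set.univ : Set Torus) = 2 * π := by
  rw [Measure.real, AddCircle.measure_univ, ENNReal.toReal_ofReal (by positivity)]

lemma lintegral_oscKernel_le (a : ℝ) :
    ∫⁻ y, ‖oscKernel a y‖ₑ ≤ ENNReal.ofReal (8 * π * Real.log 2) := by
  rw [← ofReal_integral_norm_eq_lintegral_enorm (integrable_oscKernel a)]
  refine ENNReal.ofReal_le_ofReal ?_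
  have hlog : 0 < Real.log 2 := Real.log_pos one_lt_two
  calc ∫ y, ‖oscKernel a y‖ ≤ ∫ y, (4 * Real.log 2 - oscKernel a y) := by
        refine integral_mono (integrable_oscKernel a).norm
          ((integrable_const _).sub (integrable_oscKernel a)) fun y => ?_
        have := oscKernel_le a y
        rw [Real.norm_eq_abs]
        exact abs_le.mpr ⟨by linarith, by linarith⟩
    _ = 8 * π * Real.log 2 := by
        rw [integral_sub (integrable_const _) (integrable_oscKernel a), integral_oscKernel,
          integral_const, volume_real_torus, smul_eq_mul]
        ring

/-- The oscillating part of the kernel as a function of two points of the strip. -/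
def oscPair (z ξ : Strip) : ℝ := oscKernel (z.1 - ξ.1) (z.2 - ξ.2)

lemma oscPair_comm (z ξ : Strip) : oscPair z ξ = oscPair ξ z := by
  rw [oscPair, ← oscKernel_neg, neg_sub, neg_sub, oscPair]

lemma measurable_oscPair : Measurable (Function.uncurry oscPair) :=
  measurable_oscKernel.comp (f := fun p : Strip × Strip => (p.1.1 - p.2.1, p.1.2 - p.2.2))
    (by fun_prop)

lemma lintegral_oscPair_slice_le (z : Strip) (x : ℝ) :
    ∫⁻ y, ‖oscPair z (x, y)‖ₑ ≤ ENNReal.ofReal (8 * π * Real.log 2) := by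
  simp only [oscPair]
  rw [lintegral_sub_left_eq_self (fun y => ‖oscKernel (z.1 - x) y‖ₑ) z.2]
  exact lintegral_oscKernel_le _

lemma integral_oscPair_slice (z : Strip) (x : ℝ) : ∫ y, oscPair z (x, y) = 0 := by
  simp only [oscPair]
  rw [integral_sub_left_eq_self (fun y => oscKernel (z.1 - x) y) volume z.2]
  exact integral_oscKernel _

lemma lintegral_oscPair_band_le (z : Strip) (B : Set ℝ) :
    ∫⁻ ξ in B ×ˢ (Set.univ : Set Torus), ‖oscPair z ξ‖ₑ ≤
      ENNReal.ofReal (8 * π * Real.log 2) * volume B := by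
  rw [Measure.volume_eq_prod, ← Measure.prod_restrict, Measure.restrict_univ,
    lintegral_prod _ (measurable_oscPair.of_uncurry_left.enorm.aemeasurable)]
  exact (lintegral_mono fun x => lintegral_oscPair_slice_le z x).trans (by simp)

lemma integral_oscPair_band (z : Strip) {B : Set ℝ} (hBf : volume B ≠ ∞) :
    ∫ ξ in B ×ˢ (Set.univ : Set Torus), oscPair z ξ = 0 := by
  have hint : IntegrableOn (oscPair z) (B ×ˢ (Set.univ : Set Torus)) :=
    ⟨measurable_oscPair.of_uncurry_left.aestronglyMeasurable,
      (lintegral_oscPair_band_le z _).trans_lt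
        (ENNReal.mul_lt_top ENNReal.ofReal_lt_top hBf.lt_top)⟩
  rw [Measure.volume_eq_prod] at hint ⊢
  rw [setIntegral_prod _ hint]
  simp [integral_oscPair_slice]

/-- A Schur-type bound: if the sublevel sets `{d ≤ t}` have length at most `4 t`, the oscillating
interaction of `A` with itself is controlled by the integral of `d` over `A`. -/
lemma lintegral_oscPair_le {d : ℝ → ℝ} (hd : Measurable d)
    (hsub : ∀ t, volume {x | d x ≤ t} ≤ ENNReal.ofReal (4 * t)) (A : Set Strip) :
    ∫⁻ z in A, ∫⁻ ξ in A, ‖oscPair z ξ‖ₑ ≤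
      ENNReal.ofReal (64 * π * Real.log 2) * ∫⁻ z in A, ENNReal.ofReal (d z.1) := by
  have hlog : 0 < Real.log 2 := Real.log_pos one_lt_two
  let k : Strip → Strip → ℝ≥0∞ := fun z ξ => if d ξ.1 ≤ d z.1 then ‖oscPair z ξ‖ₑ else 0
  have hkm : Measurable (Function.uncurry k) := by
    refine Measurable.ite ?_ measurable_oscPair.enorm measurable_const
    exact measurableSet_le (by fun_prop) (by fun_prop)
  have hk : ∀ z ξ, ‖oscPair z ξ‖ₑ ≤ k z ξ + k ξ z := by
    intro z ξ
    rcases le_total (d ξ.1) (d z.1) with h | h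
    · simp [k, h]
    · simp [k, h, oscPair_comm z ξ]
  have hrow : ∀ z, ∫⁻ ξ in A, k z ξ ≤
      ENNReal.ofReal (32 * π * Real.log 2) * ENNReal.ofReal (d z.1) := by
    intro z
    have hBm : MeasurableSet {x | d x ≤ d z.1} := measurableSet_le hd measurable_const
    calc ∫⁻ ξ in A, k z ξ ≤ ∫⁻ ξ, k z ξ := setLIntegral_le_lintegral _ _
      _ = ∫⁻ ξ in {x | d x ≤ d z.1} ×ˢ (Set.univ : Set Torus), ‖oscPair z ξ‖ₑ := by
          rw [← lintegral_indicator (hBm.prod MeasurableSet.univ)]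
          refine lintegral_congr fun ξ => ?_
          simp [k, Set.indicator]
      _ ≤ ENNReal.ofReal (8 * π * Real.log 2) * ENNReal.ofReal (4 * d z.1) :=
          (lintegral_oscPair_band_le z _).trans (by gcongr; exact hsub _)
      _ = _ := by
          rw [← ENNReal.ofReal_mul (by positivity), ← ENNReal.ofReal_mul (by positivity)]
          ring_nf
  have hswap : ∫⁻ z in A, ∫⁻ ξ in A, k ξ z = ∫⁻ z in A, ∫⁻ ξ in A, k z ξ :=
    lintegral_lintegral_swap (hkm.comp measurable_swap).aemeasurable
  calc ∫⁻ z in A, ∫⁻ ξ in A, ‖oscPair z ξ‖ₑ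
      ≤ ∫⁻ z in A, ∫⁻ ξ in A, (k z ξ + k ξ z) :=
        lintegral_mono fun z => lintegral_mono fun ξ => hk z ξ
    _ = (∫⁻ z in A, ∫⁻ ξ in A, k z ξ) + ∫⁻ z in A, ∫⁻ ξ in A, k ξ z := by
        rw [← lintegral_add_left hkm.lintegral_prod_right]
        refine lintegral_congr fun z => lintegral_add_left hkm.of_uncurry_left _
    _ = 2 * ∫⁻ z in A, ∫⁻ ξ in A, k z ξ := by rw [hswap, ← two_mul]
    _ ≤ 2 * ∫⁻ z in A, ENNReal.ofReal (32 * π * Real.log 2) * ENNReal.ofReal (d z.1) := by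
        gcongr with z; exact hrow z
    _ = _ := by
        rw [lintegral_const_mul _ (by fun_prop), ← mul_assoc,
          show (2 : ℝ≥0∞) = ENNReal.ofReal 2 by simp, ← ENNReal.ofReal_mul (by norm_num)]
        ring_nf

lemma integrableOn_oscPair {A B : Set Strip} (hA : IntegrableOn (fun z : Strip => |z.1|) A)
    (hB : IntegrableOn (fun z : Strip => |z.1|) B) :
    IntegrableOn (Function.uncurry oscPair) (A ×ˢ B) := by
  have h := lintegral_oscPair_le (d := fun x => |x|) (by fun_prop) (fun t => by
    have : {x : ℝ | |x| ≤ t} = Set.Icc (-t) t := by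
      ext x; simp only [Set.mem_ofPred_eq, abs_le, Set.mem_Icc]
    rw [this, Real.volume_Icc]
    rcases le_total 0 t with ht | ht
    · exact ENNReal.ofReal_le_ofReal (by linarith)
    · rw [ENNReal.ofReal_of_nonpos (by linarith)]; exact zero_le) (A ∪ B)
  have hAB : IntegrableOn (Function.uncurry oscPair) ((A ∪ B) ×ˢ (A ∪ B)) := by
    refine ⟨measurable_oscPair.aestronglyMeasurable, ?_⟩
    rw [Measure.volume_eq_prod, ← Measure.prod_restrict, HasFiniteIntegral,
      lintegral_prod _ measurable_oscPair.enorm.aemeasurable]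
    exact h.trans_lt (ENNReal.mul_lt_top ENNReal.ofReal_lt_top (hA.union hB).lintegral_lt_top)
  exact hAB.mono_set (Set.prod_mono Set.subset_union_left Set.subset_union_right)

/-- The oscillating energy of `E` is controlled by the symmetric difference with any band. -/
lemma abs_integral_oscPair_le {d : ℝ → ℝ} (hd : Measurable d) (hd0 : ∀ x, 0 ≤ d x)
    (hsub : ∀ t, volume {x | d x ≤ t} ≤ ENNReal.ofReal (4 * t)) {E : Set Strip} {B : Set ℝ}
    (hE : MeasurableSet E) (hB : MeasurableSet B) (hBf : volume B ≠ ∞)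
    (hEi : IntegrableOn (fun z : Strip => |z.1|) E)
    (hBi : IntegrableOn (fun z : Strip => |z.1|) (B ×ˢ (Set.univ : Set Torus)))
    (hdi : IntegrableOn (fun z : Strip => d z.1) (symmDiff E (B ×ˢ (Set.univ : Set Torus)))) :
    |∫ p in E ×ˢ E, Function.uncurry oscPair p| ≤
      64 * π * Real.log 2 * ∫ z in symmDiff E (B ×ˢ (Set.univ : Set Torus)), d z.1 := by
  have hlog : 0 < Real.log 2 := Real.log_pos one_lt_two
  set E₀ : Set Strip := B ×ˢ (Set.univ : Set Torus)
  have hE₀m : MeasurableSet E₀ := hB.prod MeasurableSet.univ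
  set g := Function.uncurry oscPair
  have i1 : IntegrableOn g (E ×ˢ E) := integrableOn_oscPair hEi hEi
  have i2 : IntegrableOn g (E ×ˢ E₀) := integrableOn_oscPair hEi hBi
  have i3 : IntegrableOn g (E₀ ×ˢ E) := integrableOn_oscPair hBi hEi
  have i4 : IntegrableOn g (E₀ ×ˢ E₀) := integrableOn_oscPair hBi hBi
  have z2 : ∀ A : Set Strip, IntegrableOn g (A ×ˢ E₀) → ∫ p in A ×ˢ E₀, g p = 0 := by
    intro A hA
    rw [Measure.volume_eq_prod] at hA ⊢
    rw [setIntegral_prod _ hA]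
    have : ∀ z, ∫ ξ in E₀, g (z, ξ) = 0 := fun z => integral_oscPair_band z hBf
    simp [this]
  have z3 : ∫ p in E₀ ×ˢ E, g p = 0 := by
    rw [← z2 E i2, Measure.volume_eq_prod, ← setIntegral_prod_swap]
    refine integral_congr_ae (Filter.Eventually.of_forall fun p => ?_)
    exact oscPair_comm _ _
  have iA : IntegrableOn g (symmDiff E E₀ ×ˢ symmDiff E E₀) := by
    have hs : symmDiff E E₀ ⊆ E ∪ E₀ := by
      rw [Set.symmDiff_def]; exact Set.union_subset_union Set.sdiff_subset Set.sdiff_subset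
    have := integrableOn_oscPair ((hEi.union hBi).mono_set hs) ((hEi.union hBi).mono_set hs)
    exact this
  have hAm : MeasurableSet (symmDiff E E₀) := hE.symmDiff hE₀m
  have m1 := hE.prod hE
  have m2 := hE.prod hE₀m
  have m3 := hE₀m.prod hE
  have m4 := hE₀m.prod hE₀m
  have j1 := (integrable_indicator_iff m1).mpr i1
  have j2 := (integrable_indicator_iff m2).mpr i2
  have j3 := (integrable_indicator_iff m3).mpr i3
  have j4 := (integrable_indicator_iff m4).mpr i4
  have e : ∫ p in E ×ˢ E, g p = ∫ p, ((E ×ˢ E).indicator g - (E ×ˢ E₀).indicator g -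
      (E₀ ×ˢ E).indicator g + (E₀ ×ˢ E₀).indicator g) p := by
    rw [integral_add' ((j1.sub j2).sub j3) j4, integral_sub' (j1.sub j2) j3, integral_sub' j1 j2,
      integral_indicator m1, integral_indicator m2, integral_indicator m3, integral_indicator m4,
      z2 E i2, z3, z2 E₀ i4]
    ring
  have hpt : ∀ p, ‖(E ×ˢ E).indicator g p - (E ×ˢ E₀).indicator g p -
      (E₀ ×ˢ E).indicator g p + (E₀ ×ˢ E₀).indicator g p‖ ≤
        (symmDiff E E₀ ×ˢ symmDiff E E₀).indicator (fun p => ‖g p‖) p := by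
    rintro ⟨z, ξ⟩
    by_cases h1 : z ∈ E <;> by_cases h2 : z ∈ E₀ <;> by_cases h3 : ξ ∈ E <;>
      by_cases h4 : ξ ∈ E₀ <;> simp [Set.indicator, Set.mem_symmDiff, h1, h2, h3, h4]
  calc |∫ p in E ×ˢ E, g p| ≤
        ∫ p, (symmDiff E E₀ ×ˢ symmDiff E E₀).indicator (fun p => ‖g p‖) p := by
        rw [e]
        exact norm_integral_le_of_norm_le
          ((integrable_indicator_iff (hAm.prod hAm)).mpr iA.norm)
          (Filter.Eventually.of_forall hpt)
    _ = (∫⁻ z in symmDiff E E₀, ∫⁻ ξ in symmDiff E E₀, ‖oscPair z ξ‖ₑ).toReal := by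
        rw [integral_indicator (hAm.prod hAm), integral_norm_eq_lintegral_enorm iA.1,
          Measure.volume_eq_prod, ← Measure.prod_restrict,
          lintegral_prod _ measurable_oscPair.enorm.aemeasurable]
        rfl
    _ ≤ (ENNReal.ofReal (64 * π * Real.log 2) *
          ∫⁻ z in symmDiff E E₀, ENNReal.ofReal (d z.1)).toReal :=
        ENNReal.toReal_mono (ENNReal.mul_ne_top ENNReal.ofReal_ne_top hdi.lintegral_lt_top.ne)
          (lintegral_oscPair_le hd hsub _)
    _ = _ := by
        rw [ENNReal.toReal_mul, ENNReal.toReal_ofReal (by positivity),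
          integral_eq_lintegral_of_nonneg_ae (Filter.Eventually.of_forall fun z => hd0 _) hdi.1]

section LayerCake

variable {α : Type*} [MeasurableSpace α] {f : α → ℝ}

lemma integrable_min_prod {σ τ : Measure α} [IsFiniteMeasure σ] [IsFiniteMeasure τ]
    (hf : Measurable f) (hf0 : ∀ a, 0 ≤ f a) (hσ : Integrable f σ) :
    Integrable (fun p : α × α => min (f p.1) (f p.2)) (σ.prod τ) := by
  refine (hσ.comp_fst τ).mono' (by fun_prop) (Filter.Eventually.of_forall fun p => ?_)
  rw [Real.norm_of_nonneg (le_min (hf0 _) (hf0 _))]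
  exact min_le_left _ _

lemma integrableOn_measureReal_lt {σ : Measure α} (hf0 : ∀ a, 0 ≤ f a) (hσ : Integrable f σ) :
    IntegrableOn (fun t => σ.real {a | t < f a}) (Set.Ioi 0) := by
  have hm : Antitone fun t => σ {a | t < f a} :=
    fun s t hst => measure_mono fun a (ha : t < f a) => hst.trans_lt ha
  refine integrable_toReal_of_lintegral_ne_top hm.measurable.aemeasurable ?_
  rw [← lintegral_eq_lintegral_meas_lt σ (Filter.Eventually.of_forall hf0) hσ.aemeasurable]
  exact hσ.lintegral_lt_top.ne

lemma measureReal_prod_lt_min {σ τ : Measure α} [SFinite τ] (t : ℝ) :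
    (σ.prod τ).real {p : α × α | t < min (f p.1) (f p.2)} =
      σ.real {a | t < f a} * τ.real {a | t < f a} := by
  rw [← measureReal_prod_prod]
  congr 1
  ext p
  simp

lemma integral_min_prod {σ τ : Measure α} [IsFiniteMeasure σ] [IsFiniteMeasure τ]
    (hf : Measurable f) (hf0 : ∀ a, 0 ≤ f a) (hσ : Integrable f σ) :
    ∫ p, min (f p.1) (f p.2) ∂(σ.prod τ) =
      ∫ t in Set.Ioi 0, σ.real {a | t < f a} * τ.real {a | t < f a} := by
  rw [(integrable_min_prod hf hf0 hσ).integral_eq_integral_meas_lt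
    (Filter.Eventually.of_forall fun p => le_min (hf0 _) (hf0 _))]
  simp only [measureReal_prod_lt_min]

lemma integrableOn_mul_measureReal_lt {σ τ : Measure α} [IsFiniteMeasure σ] [IsFiniteMeasure τ]
    (hf : Measurable f) (hf0 : ∀ a, 0 ≤ f a) (hσ : Integrable f σ) :
    IntegrableOn (fun t => σ.real {a | t < f a} * τ.real {a | t < f a}) (Set.Ioi 0) := by
  have h := integrableOn_measureReal_lt (f := fun p : α × α => min (f p.1) (f p.2))
    (fun p => le_min (hf0 _) (hf0 _)) (integrable_min_prod (τ := τ) hf hf0 hσ)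
  simpa only [measureReal_prod_lt_min] using h

/-- If the tails of `f` under `σ` dominate those under `σ₀`, then the self-interaction of `σ`
through `min` is controlled by the interaction with `σ₀` and first moments. -/
lemma integral_min_prod_self_le {σ σ₀ : Measure α} [IsFiniteMeasure σ] [IsFiniteMeasure σ₀]
    (hf : Measurable f) (hf0 : ∀ a, 0 ≤ f a) (hσ : Integrable f σ) (hσ₀ : Integrable f σ₀)
    (hle : ∀ t, σ₀.real {a | t < f a} ≤ σ.real {a | t < f a}) :
    ∫ p, min (f p.1) (f p.2) ∂(σ.prod σ) + σ.real Set.univ * ∫ a, f a ∂σ₀ ≤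
      σ.real Set.univ * ∫ a, f a ∂σ + ∫ p, min (f p.1) (f p.2) ∂(σ.prod σ₀) := by
  have i1 := integrableOn_mul_measureReal_lt (τ := σ) hf hf0 hσ
  have i2 := integrableOn_mul_measureReal_lt (τ := σ₀) hf hf0 hσ
  have i3 := (integrableOn_measureReal_lt hf0 hσ).const_mul (σ.real Set.univ)
  have i4 := (integrableOn_measureReal_lt hf0 hσ₀).const_mul (σ.real Set.univ)
  rw [integral_min_prod hf hf0 hσ, integral_min_prod hf hf0 hσ,
    hσ.integral_eq_integral_meas_lt (Filter.Eventually.of_forall hf0),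
    hσ₀.integral_eq_integral_meas_lt (Filter.Eventually.of_forall hf0),
    ← integral_const_mul, ← integral_const_mul, ← integral_add i1 i4, ← integral_add i3 i2]
  refine integral_mono (i1.add i4) (i3.add i2) fun t => ?_
  have h1 : σ.real {a | t < f a} ≤ σ.real Set.univ := measureReal_mono (Set.subset_univ _)
  have h2 := hle t
  simp only
  nlinarith [mul_nonneg (sub_nonneg.mpr h1) (sub_nonneg.mpr h2)]

/-- Among the subsets of `H` with given measure, a sublevel set of `f` has the smallest tails. -/
lemma measureReal_sublevel_tail_le {μ : Measure α} {H S S₀ : Set α} {L : ℝ}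
    (hf : Measurable f) (hS₀ : S₀ = H ∩ {a | f a ≤ L})
    (hSH : S ⊆ H) (heq : μ S = μ S₀) (hfin : μ S ≠ ∞) (t : ℝ) :
    (μ.restrict S₀).real {a | t < f a} ≤ (μ.restrict S).real {a | t < f a} := by
  have hm : MeasurableSet {a | t < f a} := measurableSet_lt measurable_const hf
  rw [measureReal_restrict_apply hm, measureReal_restrict_apply hm]
  rcases lt_or_ge L t with h | h
  · have : {a | t < f a} ∩ S₀ = ∅ := by
      ext a
      simp only [hS₀, Set.mem_inter_iff, Set.mem_ofPred_eq, Set.mem_empty_iff_false, iff_false]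
      rintro ⟨h1, -, h2⟩
      linarith
    rw [this, measureReal_empty]
    exact measureReal_nonneg
  · have e1 := measureReal_inter_add_sdiff (μ := μ) (s := S) (t := {a | t < f a}) hm hfin
    have e2 := measureReal_inter_add_sdiff (μ := μ) (s := S₀) (t := {a | t < f a}) hm (heq ▸ hfin)
    have e3 : μ.real S = μ.real S₀ := by rw [Measure.real, heq, Measure.real]
    have e4 : μ.real (S \ {a | t < f a}) ≤ μ.real (S₀ \ {a | t < f a}) := by
      refine measureReal_mono ?_ (measure_ne_top_of_subset Set.sdiff_subset (heq ▸ hfin))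
      rintro a ⟨ha, hat⟩
      simp only [Set.mem_ofPred_eq, not_lt] at hat
      refine ⟨?_, by simpa using hat⟩
      rw [hS₀]
      exact ⟨hSH ha, hat.trans h⟩
    rw [Set.inter_comm _ S₀, Set.inter_comm _ S]
    linarith

lemma setIntegral_symmDiff {μ : Measure α} {S T : Set α} {g : α → ℝ} (hS : MeasurableSet S)
    (hT : MeasurableSet T) (hgS : IntegrableOn g S μ) (hgT : IntegrableOn g T μ) :
    ∫ a in symmDiff S T, g a ∂μ = ∫ a in S \ T, g a ∂μ + ∫ a in T \ S, g a ∂μ := by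
  rw [Set.symmDiff_def]
  exact setIntegral_union (disjoint_sdiff_sdiff) (hT.diff hS)
    (hgS.mono_set Set.sdiff_subset) (hgT.mono_set Set.sdiff_subset)

lemma le_sub_setIntegral {μ : Measure α} {S T : Set α} {Θ g : α → ℝ} {κ : ℝ}
    (hS : MeasurableSet S) (hT : MeasurableSet T) (heq : μ S = μ T) (hfin : μ S ≠ ∞)
    (hΘS : IntegrableOn Θ S μ) (hΘT : IntegrableOn Θ T μ)
    (hgS : IntegrableOn g S μ) (hgT : IntegrableOn g T μ)
    (h1 : ∀ a ∈ S \ T, g a ≤ Θ a - κ) (h2 : ∀ a ∈ T \ S, g a ≤ κ - Θ a) :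
    ∫ a in symmDiff S T, g a ∂μ ≤ ∫ a in S, Θ a ∂μ - ∫ a in T, Θ a ∂μ := by
  have hfinT : μ T ≠ ∞ := heq ▸ hfin
  have cS : IntegrableOn (fun _ => κ) S μ := integrableOn_const hfin
  have cT : IntegrableOn (fun _ => κ) T μ := integrableOn_const hfinT
  have e1 := integral_inter_add_sdiff hT (hΘS.sub cS)
  have e2 := integral_inter_add_sdiff hS (cT.sub hΘT)
  have e3 := integral_inter_add_sdiff hT cS
  have e4 := integral_inter_add_sdiff hS cT
  have e5 := integral_inter_add_sdiff hT hΘS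
  have e6 := integral_inter_add_sdiff hS hΘT
  have m1 : ∫ a in S \ T, g a ∂μ ≤ ∫ a in S \ T, (Θ a - κ) ∂μ :=
    setIntegral_mono_on (hgS.mono_set Set.sdiff_subset)
      ((hΘS.sub cS).mono_set Set.sdiff_subset) (hS.diff hT) h1
  have m2 : ∫ a in T \ S, g a ∂μ ≤ ∫ a in T \ S, (κ - Θ a) ∂μ :=
    setIntegral_mono_on (hgT.mono_set Set.sdiff_subset)
      ((cT.sub hΘT).mono_set Set.sdiff_subset) (hT.diff hS) h2
  rw [integral_sub (hΘS.mono_set Set.sdiff_subset) (cS.mono_set Set.sdiff_subset)] at m1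
  rw [integral_sub (cT.mono_set Set.sdiff_subset) (hΘT.mono_set Set.sdiff_subset)] at m2
  have k1 : ∫ _ in S, κ ∂μ = ∫ _ in T, κ ∂μ := by
    rw [setIntegral_const, setIntegral_const, Measure.real, heq, Measure.real]
  rw [setIntegral_symmDiff hS hT hgS hgT]
  rw [Set.inter_comm T S] at e4 e6
  linarith

/-- One-sided quantitative bathtub estimate for the energy
`4 m ∫ f - 2 ∫∫ min (f a) (f b)` of sets of measure `m`. -/
lemma half_energy_ge {μ : Measure α} [SFinite μ] {H S S₀ : Set α} {L m : ℝ} (hL : 0 < L)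
    (hf : Measurable f) (hf0 : ∀ a, 0 ≤ f a) (hS : MeasurableSet S) (hS₀m : MeasurableSet S₀)
    (hS₀ : S₀ = H ∩ {a | f a ≤ L}) (hSH : S ⊆ H) (heq : μ S = μ S₀) (hfin : μ S ≠ ∞)
    (hm : μ.real S₀ = m) (hfS : IntegrableOn f S μ) (hfS₀ : IntegrableOn f S₀ μ)
    (hmom : ∫ a in S₀, f a ∂μ = m * L / 2) :
    m * ∫ a in symmDiff S S₀, |f a - L| ∂μ ≤
      (4 * m * ∫ a in S, f a ∂μ -
        2 * ∫ p, min (f p.1) (f p.2) ∂((μ.restrict S).prod (μ.restrict S))) -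
      (4 * m * ∫ a in S₀, f a ∂μ -
        2 * ∫ p, min (f p.1) (f p.2) ∂((μ.restrict S₀).prod (μ.restrict S₀))) := by
  have hfin₀ : μ S₀ ≠ ∞ := heq ▸ hfin
  have hm0 : 0 ≤ m := hm ▸ measureReal_nonneg
  have : IsFiniteMeasure (μ.restrict S) := isFiniteMeasure_restrict.mpr hfin
  have : IsFiniteMeasure (μ.restrict S₀) := isFiniteMeasure_restrict.mpr hfin₀
  have hmS : (μ.restrict S).real Set.univ = m := by
    rw [measureReal_restrict_apply MeasurableSet.univ, Set.univ_inter, ← hm, Measure.real, heq,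
      Measure.real]
  have key := integral_min_prod_self_le hf hf0 hfS hfS₀
    (measureReal_sublevel_tail_le hf hS₀ hSH heq hfin)
  rw [hmS] at key
  let ψ : α → ℝ := fun a => ∫ b in S₀, min (f a) (f b) ∂μ
  have iS := integrable_min_prod (τ := μ.restrict S₀) hf hf0 hfS
  have iS₀ := integrable_min_prod (τ := μ.restrict S₀) hf hf0 hfS₀
  have hψS : IntegrableOn ψ S μ := iS.integral_prod_left
  have hψS₀ : IntegrableOn ψ S₀ μ := iS₀.integral_prod_left
  have eS : ∫ p, min (f p.1) (f p.2) ∂((μ.restrict S).prod (μ.restrict S₀)) =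
      ∫ a in S, ψ a ∂μ := integral_prod _ iS
  have eS₀ : ∫ p, min (f p.1) (f p.2) ∂((μ.restrict S₀).prod (μ.restrict S₀)) =
      ∫ a in S₀, ψ a ∂μ := integral_prod _ iS₀
  have imin : ∀ a, IntegrableOn (fun b => min (f a) (f b)) S₀ μ := fun a =>
    hfS₀.mono' (by fun_prop) (Filter.Eventually.of_forall fun b => by
      rw [Real.norm_of_nonneg (le_min (hf0 _) (hf0 _))]; exact min_le_right _ _)
  have hψle : ∀ a, ψ a ≤ m * L / 2 := fun a => by
    rw [← hmom]
    exact integral_mono (imin a) hfS₀ fun b => min_le_right _ _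
  have hψge : ∀ a, f a ≤ L → m * f a / 2 ≤ ψ a := fun a ha => by
    have : ∫ b in S₀, f a / L * f b ∂μ ≤ ψ a := by
      refine setIntegral_mono_on (hfS₀.const_mul _) (imin a) hS₀m fun b hb => ?_
      have hb' : f b ≤ L := by rw [hS₀] at hb; exact hb.2
      refine le_min ?_ ?_
      · rw [div_mul_eq_mul_div, div_le_iff₀ hL]
        exact mul_le_mul_of_nonneg_left hb' (hf0 a)
      · exact mul_le_of_le_one_left (hf0 b) ((div_le_one hL).mpr ha)
    rw [integral_const_mul, hmom] at this
    refine le_of_eq_of_le ?_ this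
    field_simp
  have cS : IntegrableOn (fun _ => L) S μ := integrableOn_const hfin
  have cS₀ : IntegrableOn (fun _ => L) S₀ μ := integrableOn_const hfin₀
  have fin := le_sub_setIntegral (μ := μ) (S := S) (T := S₀)
    (Θ := fun a => 2 * m * f a - 2 * ψ a) (g := fun a => m * |f a - L|) (κ := m * L)
    hS hS₀m heq hfin ((hfS.const_mul _).sub (hψS.const_mul _))
    ((hfS₀.const_mul _).sub (hψS₀.const_mul _))
    ((hfS.sub cS).abs.const_mul _) ((hfS₀.sub cS₀).abs.const_mul _)
    (fun a ha => by
      have : L < f a := by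
        by_contra hcon
        exact ha.2 (hS₀ ▸ ⟨hSH ha.1, not_lt.mp hcon⟩)
      rw [abs_of_pos (sub_pos.mpr this)]
      nlinarith [hψle a])
    (fun a ha => by
      have h1 : f a ≤ L := by have := ha.1; rw [hS₀] at this; exact this.2
      rw [abs_of_nonpos (sub_nonpos.mpr h1)]
      nlinarith [hψge a h1])
  rw [integral_const_mul, integral_sub (hfS.const_mul _) (hψS.const_mul _),
    integral_sub (hfS₀.const_mul _) (hψS₀.const_mul _)] at fin
  simp only [integral_const_mul] at fin
  linarith

end LayerCake

/-- The first-moment part of the energy. -/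
def linEnergy (E : Set Strip) : ℝ := ∫ p in E ×ˢ E, |p.1.1 - p.2.1|

lemma integrableOn_abs_fst_sub {E : Set Strip} (hfin : volume E ≠ ∞)
    (hEi : IntegrableOn (fun z : Strip => |z.1|) E) :
    IntegrableOn (fun p : Strip × Strip => |p.1.1| + |p.2.1|) (E ×ˢ E) ∧
    IntegrableOn (fun p : Strip × Strip => |p.1.1 - p.2.1|) (E ×ˢ E) := by
  have : IsFiniteMeasure (volume.restrict E) := isFiniteMeasure_restrict.mpr hfin
  have h : IntegrableOn (fun p : Strip × Strip => |p.1.1| + |p.2.1|) (E ×ˢ E) := by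
    rw [IntegrableOn, Measure.volume_eq_prod, ← Measure.prod_restrict]
    exact (Integrable.comp_fst hEi _).add (Integrable.comp_snd hEi _)
  refine ⟨h, h.mono' (by fun_prop) (Filter.Eventually.of_forall fun p => ?_)⟩
  rw [Real.norm_eq_abs, abs_abs]
  exact abs_sub _ _

lemma Freg_eq {E : Set Strip} (hfin : volume E ≠ ∞)
    (hEi : IntegrableOn (fun z : Strip => |z.1|) E) :
    Freg E = linEnergy E - Real.log 2 * volume.real E ^ 2 +
      ∫ p in E ×ˢ E, Function.uncurry oscPair p := by
  have i1 := (integrableOn_abs_fst_sub hfin hEi).2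
  have i2 := integrableOn_oscPair hEi hEi
  have i3 : IntegrableOn (fun _ : Strip × Strip => Real.log 2) (E ×ˢ E) :=
    integrableOn_const (by
      rw [Measure.volume_eq_prod, Measure.prod_prod]; exact ENNReal.mul_ne_top hfin hfin)
  have i4 := (i1.sub i3).add i2
  have e : Freg E = ∫ p in E ×ˢ E, (((fun p : Strip × Strip => |p.1.1 - p.2.1|) -
      fun _ : Strip × Strip => Real.log 2) + Function.uncurry oscPair) p := by
    rw [Measure.volume_eq_prod] at i4 ⊢
    rw [setIntegral_prod _ i4, Freg]
    simp only [log_cosh_sub_cosT]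
    rfl
  rw [e, integral_add' (i1.sub i3) i2, integral_sub' i1 i3, setIntegral_const, linEnergy,
    Measure.volume_eq_prod, measureReal_prod_prod, smul_eq_mul]
  ring

lemma abs_sub_eq_min (a b : ℝ) : |a - b| = |a| + |b| -
    2 * (if 0 < a ∧ 0 < b then min |a| |b| else 0) -
    2 * (if a < 0 ∧ b < 0 then min |a| |b| else 0) := by
  rcases lt_trichotomy a 0 with ha | rfl | ha <;> rcases lt_trichotomy b 0 with hb | rfl | hb
  · rw [if_neg (by simp [ha.le]), if_pos ⟨ha, hb⟩, abs_of_neg ha, abs_of_neg hb]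
    rcases le_total a b with h | h
    · rw [abs_of_nonpos (by linarith), min_eq_right (by linarith)]; ring
    · rw [abs_of_nonneg (by linarith), min_eq_left (by linarith)]; ring
  · simp
  · rw [if_neg (by simp [ha.le]), if_neg (by simp [hb.le]), abs_of_neg ha, abs_of_pos hb,
      abs_of_neg (by linarith)]; ring
  · simp
  · simp
  · simp
  · rw [if_neg (by simp [hb.le]), if_neg (by simp [ha.le]), abs_of_pos ha, abs_of_neg hb,
      abs_of_pos (by linarith)]; ring
  · simp
  · rw [if_pos ⟨ha, hb⟩, if_neg (by simp [ha.le]), abs_of_pos ha, abs_of_pos hb]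
    rcases le_total a b with h | h
    · rw [abs_of_nonpos (by linarith), min_eq_left (by linarith)]; ring
    · rw [abs_of_nonneg (by linarith), min_eq_right (by linarith)]; ring

/-- The right half of the strip. -/
def rightHalf : Set Strip := {z | 0 < z.1}

/-- The left half of the strip. -/
def leftHalf : Set Strip := {z | z.1 < 0}

lemma measurableSet_rightHalf : MeasurableSet rightHalf :=
  measurableSet_lt measurable_const measurable_fst

lemma measurableSet_leftHalf : MeasurableSet leftHalf :=
  measurableSet_lt measurable_fst measurable_const

lemma setIntegral_halves {A : Set Strip} {g : Strip → ℝ} (hA : MeasurableSet A)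
    (hg : IntegrableOn g A) :
    ∫ z in A, g z = (∫ z in A ∩ rightHalf, g z) + ∫ z in A ∩ leftHalf, g z := by
  have hd : Disjoint (A ∩ rightHalf) (A ∩ leftHalf) := by
    refine Set.disjoint_left.mpr fun z h1 h2 => ?_
    exact lt_asymm (show 0 < z.1 from h1.2) (show z.1 < 0 from h2.2)
  rw [← setIntegral_union hd (hA.inter measurableSet_leftHalf)
    (hg.mono_set Set.inter_subset_left) (hg.mono_set Set.inter_subset_left)]
  refine setIntegral_congr_set ?_
  have hnull : volume (({0} : Set ℝ) ×ˢ (Set.univ : Set Torus)) = 0 := by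
    rw [Measure.volume_eq_prod, Measure.prod_prod]; simp
  filter_upwards [compl_mem_ae_iff.mpr hnull] with z hz
  have hz' : z.1 ≠ 0 := by simpa using hz
  refine propext ⟨fun h => ?_, fun h => h.elim (fun h => h.1) (fun h => h.1)⟩
  exact hz'.lt_or_gt.elim (fun h' => Or.inr ⟨h, h'⟩) (fun h' => Or.inl ⟨h, h'⟩)

/-- The self-interaction of `S` through the minimum of the distances to the axis. -/
def minEnergy (S : Set Strip) : ℝ :=
  ∫ p, min |p.1.1| |p.2.1| ∂(((volume : Measure Strip).restrict S).prod (volume.restrict S))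

lemma setIntegral_indicator_min (E : Set Strip) {H : Set Strip} (hH : MeasurableSet H) :
    ∫ p in E ×ˢ E, (H ×ˢ H).indicator (fun p : Strip × Strip => min |p.1.1| |p.2.1|) p =
      minEnergy (E ∩ H) := by
  rw [setIntegral_indicator (hH.prod hH), Set.prod_inter_prod, minEnergy, Measure.prod_restrict,
    Measure.volume_eq_prod]

lemma linEnergy_eq {E : Set Strip} (hfin : volume E ≠ ∞)
    (hEi : IntegrableOn (fun z : Strip => |z.1|) E) :
    linEnergy E = 2 * volume.real E * (∫ z in E, |z.1|) -
      2 * minEnergy (E ∩ rightHalf) - 2 * minEnergy (E ∩ leftHalf) := by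
  have : IsFiniteMeasure (volume.restrict E) := isFiniteMeasure_restrict.mpr hfin
  have i1 := (integrableOn_abs_fst_sub hfin hEi).1
  have i0 : IntegrableOn (fun p : Strip × Strip => min |p.1.1| |p.2.1|) (E ×ˢ E) := by
    rw [IntegrableOn, Measure.volume_eq_prod, ← Measure.prod_restrict]
    exact integrable_min_prod (f := fun z : Strip => |z.1|) (by fun_prop)
      (fun _ => abs_nonneg _) hEi
  have i2 := (i0.indicator (measurableSet_rightHalf.prod measurableSet_rightHalf)).const_mul 2
  have i3 := (i0.indicator (measurableSet_leftHalf.prod measurableSet_leftHalf)).const_mul 2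
  have hpt : ∀ p : Strip × Strip, |p.1.1 - p.2.1| = (|p.1.1| + |p.2.1|) -
      2 * (rightHalf ×ˢ rightHalf).indicator (fun p : Strip × Strip => min |p.1.1| |p.2.1|) p -
      2 * (leftHalf ×ˢ leftHalf).indicator (fun p : Strip × Strip => min |p.1.1| |p.2.1|) p := by
    intro p
    rw [abs_sub_eq_min]
    simp [Set.indicator, rightHalf, leftHalf, Set.mem_prod]
  have e1 : ∫ p in E ×ˢ E, (|p.1.1| + |p.2.1|) = 2 * volume.real E * ∫ z in E, |z.1| := by
    rw [Measure.volume_eq_prod, ← Measure.prod_restrict,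
      integral_add (Integrable.comp_fst hEi _) (Integrable.comp_snd hEi _),
      integral_fun_fst (fun z : Strip => |z.1|), integral_fun_snd (fun z : Strip => |z.1|)]
    simp only [measureReal_restrict_apply MeasurableSet.univ, Set.univ_inter, smul_eq_mul]
    ring
  rw [linEnergy, integral_congr_ae (Filter.Eventually.of_forall hpt), 
    integral_sub (by exact i1.sub i2) i3, integral_sub i1 i2, integral_const_mul, integral_const_mul, e1,
    setIntegral_indicator_min _ measurableSet_rightHalf,
    setIntegral_indicator_min _ measurableSet_leftHalf]

/-- The centered band `[-L, L] × 𝕋`. -/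
def band (L : ℝ) : Set Strip := Set.Icc (-L) L ×ˢ (Set.univ : Set Torus)

lemma volume_prod_univ (B : Set ℝ) :
    volume (B ×ˢ (Set.univ : Set Torus)) = volume B * ENNReal.ofReal (2 * π) := by
  rw [Measure.volume_eq_prod, Measure.prod_prod, AddCircle.measure_univ]

lemma setIntegral_abs_prod_univ (B : Set ℝ) :
    ∫ z in B ×ˢ (Set.univ : Set Torus), |z.1| = 2 * π * ∫ x in B, |x| := by
  rw [Measure.volume_eq_prod, ← Measure.prod_restrict, integral_fun_fst (fun x : ℝ => |x|),
    measureReal_restrict_apply MeasurableSet.univ, Set.univ_inter, volume_real_torus, smul_eq_mul]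

lemma band_inter_rightHalf (L : ℝ) :
    band L ∩ rightHalf = Set.Ioc 0 L ×ˢ (Set.univ : Set Torus) := by
  ext z
  simp only [band, rightHalf, Set.mem_inter_iff, Set.mem_prod, Set.mem_Icc, Set.mem_univ,
    and_true, Set.mem_ofPred_eq, Set.mem_Ioc]
  constructor
  · rintro ⟨⟨h1, h2⟩, h3⟩; exact ⟨h3, h2⟩
  · rintro ⟨h1, h2⟩; exact ⟨⟨by linarith, h2⟩, h1⟩

lemma band_inter_leftHalf (L : ℝ) :
    band L ∩ leftHalf = Set.Ico (-L) 0 ×ˢ (Set.univ : Set Torus) := by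
  ext z
  simp only [band, leftHalf, Set.mem_inter_iff, Set.mem_prod, Set.mem_Icc, Set.mem_univ,
    and_true, Set.mem_ofPred_eq, Set.mem_Ico]
  constructor
  · rintro ⟨⟨h1, h2⟩, h3⟩; exact ⟨h1, h3⟩
  · rintro ⟨h1, h2⟩; exact ⟨⟨h1, by linarith⟩, h2⟩

lemma integral_abs_Ioc {L : ℝ} (hL : 0 ≤ L) : ∫ x in Set.Ioc 0 L, |x| = L ^ 2 / 2 := by
  rw [setIntegral_congr_fun (g := fun x => x) measurableSet_Ioc fun x hx => abs_of_pos hx.1,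
    ← intervalIntegral.integral_of_le hL, integral_id]
  ring

lemma integral_abs_Ico {L : ℝ} (hL : 0 ≤ L) : ∫ x in Set.Ico (-L) 0, |x| = L ^ 2 / 2 := by
  rw [setIntegral_congr_fun (g := fun x => -x) measurableSet_Ico fun x hx => abs_of_neg hx.2,
    integral_Ico_eq_integral_Ioc, ← intervalIntegral.integral_of_le (by linarith),
    intervalIntegral.integral_neg, integral_id]
  ring

lemma volume_band {L : ℝ} (hL : 0 ≤ L) : volume (band L) = ENNReal.ofReal (4 * π * L) := by
  rw [band, volume_prod_univ, Real.volume_Icc, ← ENNReal.ofReal_mul (by linarith)]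
  congr 1; ring

lemma integrableOn_abs_band {L : ℝ} (hL : 0 ≤ L) :
    IntegrableOn (fun z : Strip => |z.1|) (band L) := by
  refine Measure.integrableOn_of_bounded (M := L) (by rw [volume_band hL]; simp) (by fun_prop) ?_
  refine (ae_restrict_iff' (measurableSet_Icc.prod MeasurableSet.univ)).mpr
    (Filter.Eventually.of_forall fun z hz => ?_)
  rw [Real.norm_eq_abs, abs_abs]
  exact abs_le.mpr hz.1

lemma band_inter_eq {L : ℝ} (H : Set Strip) : band L ∩ H = H ∩ {z | |z.1| ≤ L} := by
  ext z
  simp only [band, Set.mem_inter_iff, Set.mem_prod, Set.mem_Icc, Set.mem_univ, and_true,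
    Set.mem_ofPred_eq, abs_le]
  exact and_comm

/-- The one-sided estimate for the half of `E` lying in `H`. -/
lemma half_strip_energy_ge {E H : Set Strip} {L : ℝ} (hL : 0 < L) (hE : MeasurableSet E)
    (hH : MeasurableSet H) (hvol : volume (E ∩ H) = ENNReal.ofReal (2 * π * L))
    (hvol₀ : volume (band L ∩ H) = ENNReal.ofReal (2 * π * L))
    (hmom : ∫ z in band L ∩ H, |z.1| = π * L ^ 2)
    (hEi : IntegrableOn (fun z : Strip => |z.1|) E) :
    2 * π * L * ∫ z in symmDiff E (band L) ∩ H, |(|z.1| - L)| ≤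
      (8 * π * L * (∫ z in E ∩ H, |z.1|) - 2 * minEnergy (E ∩ H)) -
      (8 * π * L * (∫ z in band L ∩ H, |z.1|) - 2 * minEnergy (band L ∩ H)) := by
  have hb : MeasurableSet (band L) := measurableSet_Icc.prod MeasurableSet.univ
  have hsymm : symmDiff E (band L) ∩ H = symmDiff (E ∩ H) (band L ∩ H) := by
    ext z
    simp only [Set.mem_symmDiff, Set.mem_inter_iff]
    tauto
  rw [hsymm]
  have h := half_energy_ge (μ := volume) (f := fun z : Strip => |z.1|) (m := 2 * π * L) hL
    (by fun_prop) (fun _ => abs_nonneg _) (hE.inter hH) (hb.inter hH) (band_inter_eq H)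
    Set.inter_subset_right (hvol.trans hvol₀.symm) (by rw [hvol]; simp)
    (by rw [Measure.real, hvol₀, ENNReal.toReal_ofReal (by positivity)])
    (hEi.mono_set Set.inter_subset_left)
    ((integrableOn_abs_band hL.le).mono_set Set.inter_subset_left)
    (by rw [hmom]; ring)
  simp only [minEnergy]
  linarith

lemma linEnergy_ge {E : Set Strip} {L : ℝ} (hL : 0 < L) (hE : MeasurableSet E)
    (hvol : volume E = ENNReal.ofReal (4 * π * L))
    (hr : volume (E ∩ rightHalf) = ENNReal.ofReal (2 * π * L))
    (hl : volume (E ∩ leftHalf) = ENNReal.ofReal (2 * π * L))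
    (hEi : IntegrableOn (fun z : Strip => |z.1|) E)
    (hdi : IntegrableOn (fun z : Strip => |(|z.1| - L)|) (symmDiff E (band L))) :
    linEnergy (band L) + 2 * π * L * ∫ z in symmDiff E (band L), |(|z.1| - L)| ≤
      linEnergy E := by
  have hb : MeasurableSet (band L) := measurableSet_Icc.prod MeasurableSet.univ
  have hbi := integrableOn_abs_band hL.le
  have hbv := volume_band hL.le
  have kr := half_strip_energy_ge hL hE measurableSet_rightHalf hr
    (by
      rw [band_inter_rightHalf, volume_prod_univ, Real.volume_Ioc,
        ← ENNReal.ofReal_mul (by linarith)]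
      congr 1; ring)
    (by rw [band_inter_rightHalf, setIntegral_abs_prod_univ, integral_abs_Ioc hL.le]; ring) hEi
  have kl := half_strip_energy_ge hL hE measurableSet_leftHalf hl
    (by
      rw [band_inter_leftHalf, volume_prod_univ, Real.volume_Ico,
        ← ENNReal.ofReal_mul (by linarith)]
      congr 1; ring)
    (by rw [band_inter_leftHalf, setIntegral_abs_prod_univ, integral_abs_Ico hL.le]; ring) hEi
  have rE : volume.real E = 4 * π * L := by
    rw [Measure.real, hvol, ENNReal.toReal_ofReal (by positivity)]
  have rb : volume.real (band L) = 4 * π * L := by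
    rw [Measure.real, hbv, ENNReal.toReal_ofReal (by positivity)]
  rw [linEnergy_eq (by rw [hvol]; simp) hEi, linEnergy_eq (by rw [hbv]; simp) hbi, rE, rb,
    setIntegral_halves hE hEi, setIntegral_halves hb hbi,
    setIntegral_halves (hE.symmDiff hb) hdi]
  linarith

lemma volume_abs_abs_sub_le (L t : ℝ) :
    volume {x : ℝ | |(|x| - L)| ≤ t} ≤ ENNReal.ofReal (4 * t) := by
  have hsub : {x : ℝ | |(|x| - L)| ≤ t} ⊆
      Set.Icc (L - t) (L + t) ∪ Set.Icc (-L - t) (-L + t) := by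
    intro x hx
    have hx' := abs_le.mp (show |(|x| - L)| ≤ t from hx)
    rcases abs_cases x with ⟨h, -⟩ | ⟨h, -⟩ <;> rw [h] at hx'
    · exact Or.inl ⟨by linarith, by linarith⟩
    · exact Or.inr ⟨by linarith, by linarith⟩
  rcases lt_or_ge t 0 with ht | ht
  · have : {x : ℝ | |(|x| - L)| ≤ t} = ∅ := by
      ext x
      simp only [Set.mem_ofPred_eq, Set.mem_empty_iff_false, iff_false, not_le]
      exact ht.trans_le (abs_nonneg _)
    simp [this]
  · refine (measure_mono hsub).trans ((measure_union_le _ _).trans ?_)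
    rw [Real.volume_Icc, Real.volume_Icc, ← ENNReal.ofReal_add (by linarith) (by linarith)]
    exact ENNReal.ofReal_le_ofReal (by linarith)

lemma Freg_band_add_le {E : Set Strip} {L : ℝ} (hL : 64 < L) (hE : MeasurableSet E)
    (hvol : volume E = ENNReal.ofReal (4 * π * L))
    (hr : volume (E ∩ rightHalf) = ENNReal.ofReal (2 * π * L))
    (hl : volume (E ∩ leftHalf) = ENNReal.ofReal (2 * π * L))
    (hEi : IntegrableOn (fun z : Strip => |z.1|) E) :
    Freg (band L) + π * L * ∫ z in symmDiff E (band L), |(|z.1| - L)| ≤ Freg E := by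
  have hL0 : 0 < L := by linarith
  have hbi := integrableOn_abs_band hL0.le
  have hbv := volume_band hL0.le
  have hfin : volume E ≠ ∞ := by rw [hvol]; simp
  have hfinb : volume (band L) ≠ ∞ := by rw [hbv]; simp
  have hs : symmDiff E (band L) ⊆ E ∪ band L := by
    rw [Set.symmDiff_def]; exact Set.union_subset_union Set.sdiff_subset Set.sdiff_subset
  have hdi : IntegrableOn (fun z : Strip => |(|z.1| - L)|) (symmDiff E (band L)) := by
    have c : IntegrableOn (fun _ : Strip => L) (E ∪ band L) :=
      integrableOn_const ((measure_union_lt_top hfin.lt_top hfinb.lt_top).ne)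
    exact IntegrableOn.mono_set ((hEi.union hbi).sub c).abs hs
  have hBf : volume (Set.Icc (-L) L) ≠ ∞ := by rw [Real.volume_Icc]; simp
  have hlin := linEnergy_ge hL0 hE hvol hr hl hEi hdi
  have hosc := abs_integral_oscPair_le (d := fun x => |(|x| - L)|) (by fun_prop)
    (fun _ => abs_nonneg _) (volume_abs_abs_sub_le L) hE measurableSet_Icc hBf hEi hbi hdi
  have hosc₀ := abs_integral_oscPair_le (d := fun x => |(|x| - L)|) (by fun_prop)
    (fun _ => abs_nonneg _) (volume_abs_abs_sub_le L) (E := band L)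
    (measurableSet_Icc.prod MeasurableSet.univ) measurableSet_Icc hBf hbi hbi
    (by rw [band, symmDiff_self]; exact integrableOn_empty)
  have hzero : ∫ p in band L ×ˢ band L, Function.uncurry oscPair p = 0 := by
    refine abs_nonpos_iff.mp (hosc₀.trans_eq ?_)
    rw [band, symmDiff_self]
    simp
  have hD : 0 ≤ ∫ z in symmDiff E (band L), |(|z.1| - L)| :=
    integral_nonneg fun _ => abs_nonneg _
  have hv : volume.real E = volume.real (band L) := by rw [Measure.real, hvol, ← hbv, Measure.real]
  rw [Freg_eq hfin hEi, Freg_eq hfinb hbi, hzero, hv]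
  have hosc' := (abs_le.mp hosc).1
  rw [← band] at hosc'
  have hlog : Real.log 2 ≤ 1 := by linarith [Real.log_two_lt_d9]
  have hcoef : 64 * π * Real.log 2 ≤ π * L := by nlinarith [Real.pi_pos]
  have := mul_le_mul_of_nonneg_right hcoef hD
  linarith

/-- There exist `c > 0` and `L₀ > 2` such that for every `L > L₀` and every
measurable `E ⊆ S` of measure `4πL`, centered around the origin, with `∫_E |x| dz < ∞`,
one has `F(χ_E) ≥ F(χ_{E₀}) + c·L·∫_{E Δ E₀} ||x|-L| dz` with `E₀ = [-L,L] × 𝕋`; in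
particular `E₀` minimizes `F` among all such sets. -/
theorem stmt_6 :
    ∃ c > (0 : ℝ), ∃ L₀ > (2 : ℝ), ∀ L > L₀, ∀ E : Set Strip, MeasurableSet E →
      volume E = ENNReal.ofReal (4 * π * L) →
      volume (E ∩ {z : Strip | 0 < z.1}) = volume E / 2 →
      volume (E ∩ {z : Strip | z.1 < 0}) = volume E / 2 →
      IntegrableOn (fun z : Strip => |z.1|) E volume →
      Freg E ≥ Freg (Set.Icc (-L) L ×ˢ (Set.univ : Set Torus)) +
          c * L * ∫ z in symmDiff E (Set.Icc (-L) L ×ˢ (Set.univ : Set Torus)),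
            |(|z.1| - L)| ∧
      Freg (Set.Icc (-L) L ×ˢ (Set.univ : Set Torus)) ≤ Freg E := by
  refine ⟨π, Real.pi_pos, 64, by norm_num, fun L hL E hE hvol hr hl hEi => ?_⟩
  have hhalf : volume E / 2 = ENNReal.ofReal (2 * π * L) := by
    rw [hvol, show (2 : ℝ≥0∞) = ENNReal.ofReal 2 by simp, ← ENNReal.ofReal_div_of_pos two_pos]
    congr 1; ring
  have h := Freg_band_add_le hL hE hvol (hr.trans hhalf) (hl.trans hhalf) hEi
  have hL0 : (0 : ℝ) < L := by linarith
  have hD : 0 ≤ π * L * ∫ z in symmDiff E (band L), |(|z.1| - L)| :=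
    mul_nonneg (by positivity) (integral_nonneg fun _ => abs_nonneg _)
  exact ⟨h, le_trans (le_add_of_nonneg_right hD) h⟩
end
end
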